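/- arXiv:2109.11184 — 4 statements merged into one kernel-verified Lean document; each statement's English description precedes it below -/
import Mathlib

section
/- If α is an algebraic number that is torsion-free (i.e., α/σ(α) is not a root of unity for every Galois conjugate σ(α) ≠ α), then for every positive integer n, M(α^n) = M(α)^n. -/
open Polynomial

noncomputable def intMinpoly (α : ℂ) : Polynomial ℤ :=
  (IsLocalization.integerNormalization (nonZeroDivisors ℤ) (minpoly ℚ α)).primPart

noncomputable def mahlerM (α : ℂ) : ℝ :=
  ((intMinpoly α).leadingCoeff.natAbs : ℝ) *
    (((intMinpoly α).map (Int.castRingHom ℂ)).roots.map (fun z => max 1 ‖z‖)).prod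

noncomputable def mahlerC (α : ℂ) : ℂ := (mahlerM α : ℝ)

def TorsionFree (α : ℂ) : Prop :=
  ∀ σ : ℂ ≃ₐ[ℚ] ℂ, σ α ≠ α → ∀ n : ℕ, 0 < n → (α / σ α) ^ n ≠ 1

theorem exists_autC_of_conj {α β : ℂ} (hα : IsAlgebraic ℚ α) (h : aeval β (minpoly ℚ α) = 0) :
    ∃ σ : ℂ ≃ₐ[ℚ] ℂ, σ α = β := by
  have hβ : IsAlgebraic ℚ β := ⟨minpoly ℚ α, minpoly.ne_zero hα.isIntegral, h⟩
  let K := algebraicClosure ℚ ℂ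
  let a : K := ⟨α, mem_algebraicClosure_iff.2 hα⟩
  let b : K := ⟨β, mem_algebraicClosure_iff.2 hβ⟩
  have : IsAlgClosure ℚ K := algebraicClosure.isAlgClosure ℚ ℂ
  have : IsAlgClosed K := IsAlgClosure.isAlgClosed ℚ
  have : Normal ℚ K := IsAlgClosure.normal ℚ K
  have hab : IsConjRoot ℚ b a := by
    have e1 : minpoly ℚ b = minpoly ℚ β := (minpoly.algebraMap_eq (algebraMap K ℂ).injective b).symm
    have e2 : minpoly ℚ a = minpoly ℚ α := (minpoly.algebraMap_eq (algebraMap K ℂ).injective a).symm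
    rw [IsConjRoot, e1, e2]
    exact (minpoly.eq_of_irreducible_of_monic (minpoly.irreducible hα.isIntegral) h
      (minpoly.monic hα.isIntegral)).symm
  obtain ⟨τ, hτ⟩ := isConjRoot_iff_exists_algEquiv.1 hab
  obtain ⟨s, hs⟩ := exists_isTranscendenceBasis K ℂ
  have := IsAlgClosed.isAlgClosure_of_transcendence_basis _ hs
  let e : Algebra.adjoin K (Set.range ((↑) : s → ℂ)) ≃+* Algebra.adjoin K (Set.range ((↑) : s → ℂ)) :=
    (hs.1.aevalEquiv.symm.toRingEquiv.trans
      (MvPolynomial.mapEquiv s τ.toRingEquiv)).trans hs.1.aevalEquiv.toRingEquiv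
  let E : ℂ ≃+* ℂ := IsAlgClosure.equivOfEquiv ℂ ℂ e
  refine ⟨AlgEquiv.ofRingEquiv (f := E) (fun r => map_ratCast E r), ?_⟩
  change E α = β
  have h1 : α = algebraMap (Algebra.adjoin K (Set.range ((↑) : s → ℂ))) ℂ (algebraMap K _ a) := rfl
  have h2 : β = algebraMap (Algebra.adjoin K (Set.range ((↑) : s → ℂ))) ℂ (algebraMap K _ b) := rfl
  have h3 : e (algebraMap K _ a) = algebraMap K _ b := by
    change hs.1.aevalEquiv (MvPolynomial.map _ (hs.1.aevalEquiv.symm (algebraMap K _ a))) = _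
    rw [AlgEquiv.commutes, MvPolynomial.algebraMap_eq, MvPolynomial.map_C, ← MvPolynomial.algebraMap_eq,
      AlgEquiv.commutes]
    congr 1
  rw [h1, IsAlgClosure.equivOfEquiv_algebraMap, h3]
  rfl

theorem intMinpoly_spec (α : ℂ) (hα : IsAlgebraic ℚ α) :
    (intMinpoly α).IsPrimitive ∧
    (intMinpoly α).map (Int.castRingHom ℂ) = C ((intMinpoly α).leadingCoeff : ℂ) *
      ((((minpoly ℚ α).aroots ℂ)).map (fun s => X - C s)).prod := by
  refine ⟨isPrimitive_primPart _, ?_⟩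
  have hm0 := minpoly.ne_zero hα.isIntegral
  obtain ⟨b, hb, hbe⟩ := IsLocalization.integerNormalization_spec (nonZeroDivisors ℤ) (minpoly ℚ α)
  set N := IsLocalization.integerNormalization (nonZeroDivisors ℤ) (minpoly ℚ α) with hN
  have hN0 : N ≠ 0 := by
    rw [hN, Ne, IsFractionRing.integerNormalization_eq_zero_iff]; exact hm0
  have hP : N = C N.content * intMinpoly α := N.eq_C_content_mul_primPart
  have hb0 : (b : ℂ) ≠ 0 := by exact_mod_cast nonZeroDivisors.ne_zero hb
  have hc0 : (N.content : ℂ) ≠ 0 := by exact_mod_cast (content_eq_zero_iff.not.2 hN0)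
  have h1 : N.map (Int.castRingHom ℂ) = C (b : ℂ) * (minpoly ℚ α).map (algebraMap ℚ ℂ) := by
    have := congrArg (Polynomial.map (algebraMap ℚ ℂ)) hbe
    rw [Polynomial.map_map] at this
    rw [show Int.castRingHom ℂ = (algebraMap ℚ ℂ).comp (algebraMap ℤ ℚ) from RingHom.ext_int _ _, this]
    ext i; simp
  have h2 : C (N.content : ℂ) * (intMinpoly α).map (Int.castRingHom ℂ)
      = C (b : ℂ) * (minpoly ℚ α).map (algebraMap ℚ ℂ) := by
    rw [← h1]; conv_rhs => rw [hP]
    simp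
  have h3 : ((intMinpoly α).map (Int.castRingHom ℂ)).roots = (minpoly ℚ α).aroots ℂ := by
    have := congrArg roots h2
    rwa [roots_C_mul _ hc0, roots_C_mul _ hb0] at this
  have h4 := (IsAlgClosed.splits ((intMinpoly α).map (Int.castRingHom ℂ))).eq_prod_roots
  rw [h3, leadingCoeff_map_of_injective (by exact Int.cast_injective)] at h4
  exact h4

theorem primitive_map_ne_zero {k : Type*} [CommRing k] [Nontrivial k] (φ : ℤ →+* k) {f : ℤ[X]}
    (hf : f.IsPrimitive) : f.map φ ≠ 0 := by
  intro h
  obtain ⟨r, hr⟩ := (IsPrincipalIdealRing.principal (RingHom.ker φ)).principal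
  have hrm : r ∈ RingHom.ker φ := by rw [hr]; exact Submodule.mem_span_singleton_self r
  have : C r ∣ f := by
    rw [C_dvd_iff_dvd_coeff]
    intro i
    have : f.coeff i ∈ RingHom.ker φ := by
      rw [RingHom.mem_ker, ← coeff_map, h, coeff_zero]
    rw [hr] at this
    exact Ideal.mem_span_singleton.1 this
  have hu := (hf r this).map φ
  rw [RingHom.mem_ker.1 hrm] at hu
  exact not_isUnit_zero hu

theorem int_dvd_of_primitive {b c : ℤ} (hb : b ≠ 0) {G K : (integralClosure ℤ ℂ)[X]}
    (hK : ∀ P : Ideal (integralClosure ℤ ℂ), P.IsPrime → K.map (Ideal.Quotient.mk P) ≠ 0)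
    (h : C (b : integralClosure ℤ ℂ) * G = C (c : integralClosure ℤ ℂ) * K) : b ∣ c := by
  obtain ⟨d, b', c', hd, hco, rfl, rfl⟩ : ∃ d b' c' : ℤ, d ≠ 0 ∧ IsCoprime b' c' ∧ b = d * b' ∧ c = d * c' := by
    have hg : Int.gcd b c ≠ 0 := by simp [Int.gcd_eq_zero_iff, hb]
    refine ⟨Int.gcd b c, b / Int.gcd b c, c / Int.gcd b c, by exact_mod_cast hg, ?_,
      (Int.mul_ediv_cancel' (Int.gcd_dvd_left ..)).symm, (Int.mul_ediv_cancel' (Int.gcd_dvd_right ..)).symm⟩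
    rw [Int.isCoprime_iff_gcd_eq_one]
    exact Int.gcd_div_gcd_div_gcd (Nat.pos_of_ne_zero hg)
  have hd' : C (d : integralClosure ℤ ℂ) ≠ 0 := by
    rw [Ne, C_eq_zero]; exact_mod_cast hd
  have h' : C (b' : integralClosure ℤ ℂ) * G = C (c' : integralClosure ℤ ℂ) * K := by
    apply mul_left_cancel₀ hd'
    rw [← mul_assoc, ← mul_assoc, ← C_mul, ← C_mul]
    exact_mod_cast h
  apply mul_dvd_mul_left
  apply IsUnit.dvd
  by_contra hu
  obtain ⟨m, hm, hbm⟩ := Ideal.exists_le_maximal (Ideal.span {b'})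
    (by rwa [Ne, Ideal.span_singleton_eq_top])
  have hbm' : b' ∈ m := hbm (Ideal.mem_span_singleton_self _)
  obtain ⟨P, hP, hPm⟩ := Ideal.exists_ideal_over_maximal_of_isIntegral (S := integralClosure ℤ ℂ) m
    (by
      intro x hx
      have : (algebraMap ℤ (integralClosure ℤ ℂ)) x = 0 := hx
      have hx0 : x = 0 := by simpa using this
      rw [hx0]; exact m.zero_mem)
  have hP' := hP.isPrime
  have hbP : (Ideal.Quotient.mk P) (b' : integralClosure ℤ ℂ) = 0 := by
    rw [Ideal.Quotient.eq_zero_iff_mem]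
    rw [← hPm] at hbm'
    simpa using hbm'
  have h2 := congrArg (Polynomial.map (Ideal.Quotient.mk P)) h'
  rw [Polynomial.map_mul, Polynomial.map_mul, map_C, map_C, hbP, C_0, zero_mul] at h2
  have hcP : (Ideal.Quotient.mk P) (c' : integralClosure ℤ ℂ) = 0 := by
    rcases mul_eq_zero.1 h2.symm with h3 | h3
    · exact C_eq_zero.1 h3
    · exact absurd h3 (hK P hP')
  obtain ⟨u, v, huv⟩ := hco
  have h3 := congrArg (fun z : ℤ => (Ideal.Quotient.mk P) (z : integralClosure ℤ ℂ)) huv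
  simp only [Int.cast_add, Int.cast_mul, map_add, map_mul, hbP, hcP, mul_zero, add_zero,
    Int.cast_one, map_one] at h3
  exact zero_ne_one h3

theorem prodX_ne_zero {k : Type*} [CommRing k] [IsDomain k] (s : Finset ℂ) (F : ℂ → k[X])
    (h : ∀ z ∈ s, F z ≠ 0) : ∏ z ∈ s, F z ≠ 0 :=
  Finset.prod_ne_zero_iff.2 h

open Classical in
theorem lc_pow {f h : ℤ[X]} (hf : f.IsPrimitive) (hh : h.IsPrimitive) {a b : ℤ} (ha : a ≠ 0)
    (hb : b ≠ 0) {n : ℕ} (hn : 0 < n) (S : Multiset ℂ)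
    (hfS : f.map (Int.castRingHom ℂ) = C (a : ℂ) * (S.map (fun s => X - C s)).prod)
    (hhS : h.map (Int.castRingHom ℂ) = C (b : ℂ) * (S.map (fun s => X - C (s ^ n))).prod) :
    b.natAbs = a.natAbs ^ n := by
  have : NeZero n := ⟨hn.ne'⟩
  obtain ⟨ζ, hζ⟩ : ∃ ζ : ℂ, IsPrimitiveRoot ζ n := ⟨_, Complex.isPrimitiveRoot_exp n hn.ne'⟩
  let O := integralClosure ℤ ℂ
  let ι : ℤ →+* O := Int.castRingHom O
  let ν : O →+* ℂ := algebraMap O ℂ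
  have hν : Function.Injective ν := Subtype.val_injective
  have hνι : ν.comp ι = Int.castRingHom ℂ := RingHom.ext_int _ _
  let g : ℂ → O := fun z => if hz : IsIntegral ℤ z then ⟨z, hz⟩ else 1
  have hg : ∀ z ∈ nthRootsFinset n (1 : ℂ), ν (g z) = z := by
    intro z hz
    rw [mem_nthRootsFinset hn] at hz
    have hi : IsIntegral ℤ z := IsIntegral.of_pow hn (by rw [hz]; exact isIntegral_one)
    simp only [g, dif_pos hi]; rfl
  have hgu : ∀ z ∈ nthRootsFinset n (1 : ℂ), (g z) ^ n = 1 := by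
    intro z hz
    apply hν
    rw [map_pow, hg z hz, map_one]
    exact (mem_nthRootsFinset hn _).1 hz
  let F : O[X] := ∏ z ∈ nthRootsFinset n (1 : ℂ), (f.map ι).comp (C (g z) * X)
  let H : O[X] := expand O n (h.map ι)
  have hFP : ∀ P : Ideal O, P.IsPrime → F.map (Ideal.Quotient.mk P) ≠ 0 := by
    intro P hP
    simp only [F, Polynomial.map_prod]
    have hdom : IsDomain (O ⧸ P) := Ideal.Quotient.isDomain P
    refine prodX_ne_zero (k := O ⧸ P) _ _ ?_
    intro z hz
    rw [Polynomial.map_comp, Polynomial.map_map, Polynomial.map_mul, map_C, map_X, Ne,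
      comp_C_mul_X_eq_zero_iff]
    · exact primitive_map_ne_zero _ hf
    · apply mem_nonZeroDivisors_of_ne_zero
      intro h0
      have := congrArg (Ideal.Quotient.mk P) (hgu z hz)
      rw [map_pow, h0, zero_pow hn.ne', map_one] at this
      exact zero_ne_one this
  have hHP : ∀ P : Ideal O, P.IsPrime → H.map (Ideal.Quotient.mk P) ≠ 0 := by
    intro P hP
    simp only [H]
    rw [Polynomial.map_expand, Polynomial.map_map, Ne, expand_eq_zero hn]
    exact primitive_map_ne_zero _ hh
  let ε : ℤ := (-1) ^ (n + 1)
  have hε : ε.natAbs = 1 := by simp [ε, Int.natAbs_pow]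
  have hHν : H.map ν = C (b : ℂ) * (S.map (fun s => X ^ n - C (s ^ n))).prod := by
    simp only [H]
    rw [Polynomial.map_expand, Polynomial.map_map, hνι, hhS, map_mul, expand_C, map_multiset_prod,
      Multiset.map_map]
    simp
  have hcard : (nthRootsFinset n (1 : ℂ)).card = n := hζ.card_nthRootsFinset
  have hfac : ∀ s : ℂ, ∏ z ∈ nthRootsFinset n (1 : ℂ), (C z * X - C s) =
      C (ε : ℂ) * (X ^ n - C (s ^ n)) := by
    intro s
    have hζ' : IsPrimitiveRoot (C ζ) n := hζ.map_of_injective C_injective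
    have h1 := hζ'.pow_sub_pow_eq_prod_sub_mul (C s) X hn
    have h2 : ∏ z ∈ nthRootsFinset n (1 : ℂ[X]), (C s - z * X) =
        ∏ z ∈ nthRootsFinset n (1 : ℂ), (C s - C z * X) := by
      symm
      apply Finset.prod_bij (fun z _ => C z)
      · intro z hz
        rw [mem_nthRootsFinset hn] at hz ⊢
        rw [← C_pow, hz, C_1]
      · intro x _ y _ hxy; exact C_injective hxy
      · intro z hz
        rw [mem_nthRootsFinset hn] at hz
        obtain ⟨i, -, rfl⟩ := hζ'.eq_pow_of_pow_eq_one hz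
        refine ⟨ζ ^ i, ?_, by simp⟩
        rw [mem_nthRootsFinset hn, ← pow_mul, mul_comm, pow_mul, hζ.pow_eq_one, one_pow]
      · intros; rfl
    calc ∏ z ∈ nthRootsFinset n (1 : ℂ), (C z * X - C s)
        = ∏ z ∈ nthRootsFinset n (1 : ℂ), ((-1) * (C s - C z * X)) :=
          Finset.prod_congr rfl (fun z _ => by ring)
      _ = _ := by
        rw [Finset.prod_mul_distrib, Finset.prod_const, hcard, ← h2, ← h1]
        simp [ε]; ring
  have hFν : F.map ν = C ((a ^ n * ε ^ S.card : ℤ) : ℂ) * (S.map (fun s => X ^ n - C (s ^ n))).prod := by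
    simp only [F, Polynomial.map_prod]
    calc _ = ∏ z ∈ nthRootsFinset n (1 : ℂ), (C (a : ℂ) * (S.map (fun s => C z * X - C s)).prod) := by
          apply Finset.prod_congr rfl
          intro z hz
          rw [Polynomial.map_comp, Polynomial.map_map, hνι, hfS, Polynomial.map_mul, map_C, map_X,
            hg z hz, mul_comp, C_comp, multiset_prod_comp, Multiset.map_map]
          simp
      _ = C (a : ℂ) ^ n * (S.map (fun s => C (ε : ℂ) * (X ^ n - C (s ^ n)))).prod := by
          rw [Finset.prod_mul_distrib, Finset.prod_const, hcard]
          congr 1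
          rw [← Multiset.map_congr rfl (fun s _ => hfac s)]
          exact (Multiset.prod_map_prod).symm
      _ = _ := by
          rw [Multiset.prod_map_mul, Multiset.map_const', Multiset.prod_replicate]
          simp only [Int.cast_mul, Int.cast_pow, C_mul, C_pow]
          ring
  have key : C (b : O) * F = C ((a ^ n * ε ^ S.card : ℤ) : O) * H := by
    apply Polynomial.map_injective ν hν
    rw [Polynomial.map_mul, Polynomial.map_mul, hFν, hHν, map_C, map_C, map_intCast ν, map_intCast ν]
    ring
  have hε0 : ε ≠ 0 := by intro h; simp [h] at hε
  have d1 := int_dvd_of_primitive hb hHP key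
  have d2 := int_dvd_of_primitive (mul_ne_zero (pow_ne_zero n ha) (pow_ne_zero _ hε0)) hFP key.symm
  have := Int.natAbs_eq_of_dvd_dvd d1 d2
  rw [this, Int.natAbs_mul, Int.natAbs_pow, Int.natAbs_pow, hε, one_pow, mul_one]

theorem torsionFree_inj {α : ℂ} (hα : IsAlgebraic ℚ α) (htf : TorsionFree α) {n : ℕ} (hn : 0 < n)
    {x y : ℂ} (hx : aeval x (minpoly ℚ α) = 0) (hy : aeval y (minpoly ℚ α) = 0)
    (hxy : x ^ n = y ^ n) : x = y := by
  obtain ⟨σ, rfl⟩ := exists_autC_of_conj hα hx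
  obtain ⟨τ, rfl⟩ := exists_autC_of_conj hα hy
  by_contra hne
  have h1 : (τ.trans σ.symm) α ≠ α := by
    intro h
    apply hne
    have := congrArg σ h
    simpa using this.symm
  refine htf _ h1 n hn ?_
  have h2 : α ^ n = ((τ.trans σ.symm) α) ^ n := by
    apply σ.injective
    simpa using hxy
  have hα0 : α ≠ 0 := by rintro rfl; simp at h1
  rw [div_pow, ← h2, div_self (pow_ne_zero n hα0)]

theorem aroots_pow {α : ℂ} (hα : IsAlgebraic ℚ α) (htf : TorsionFree α) {n : ℕ} (hn : 0 < n) :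
    (minpoly ℚ (α ^ n)).aroots ℂ = ((minpoly ℚ α).aroots ℂ).map (· ^ n) := by
  have hαn : IsAlgebraic ℚ (α ^ n) := hα.pow n
  have hm : minpoly ℚ α ≠ 0 := minpoly.ne_zero hα.isIntegral
  have hmn : minpoly ℚ (α ^ n) ≠ 0 := minpoly.ne_zero hαn.isIntegral
  have nd : ∀ {β : ℂ}, IsAlgebraic ℚ β → ((minpoly ℚ β).aroots ℂ).Nodup := fun hβ =>
    nodup_aroots_iff_of_splits (minpoly.ne_zero hβ.isIntegral) (IsAlgClosed.splits _) |>.2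
      (minpoly.irreducible hβ.isIntegral).separable
  rw [Multiset.Nodup.ext (nd hαn)]
  · intro z
    rw [Multiset.mem_map, mem_aroots]
    constructor
    · rintro ⟨-, hz⟩
      obtain ⟨σ, rfl⟩ := exists_autC_of_conj hαn hz
      refine ⟨σ α, ?_, (map_pow σ α n).symm⟩
      rw [mem_aroots]
      refine ⟨hm, ?_⟩
      rw [← AlgEquiv.coe_toAlgHom, aeval_algHom_apply, minpoly.aeval, map_zero]
    · rintro ⟨w, hw, rfl⟩
      rw [mem_aroots] at hw
      obtain ⟨σ, rfl⟩ := exists_autC_of_conj hα hw.2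
      refine ⟨hmn, ?_⟩
      change aeval (σ α ^ n) _ = 0
      rw [← map_pow, ← AlgEquiv.coe_toAlgHom, aeval_algHom_apply, minpoly.aeval, map_zero]
  · refine Multiset.Nodup.map_on ?_ (nd hα)
    intro x hx y hy hxy
    rw [mem_aroots] at hx hy
    exact torsionFree_inj hα htf hn hx.2 hy.2 hxy

theorem mahler_pow_of_torsionFree (α : ℂ) (hα : IsAlgebraic ℚ α)
    (htf : TorsionFree α) (n : ℕ) (hn : 0 < n) :
    mahlerM (α ^ n) = (mahlerM α) ^ n := by
  have hαn : IsAlgebraic ℚ (α ^ n) := hα.pow n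
  obtain ⟨p1, e1⟩ := intMinpoly_spec α hα
  obtain ⟨p2, e2⟩ := intMinpoly_spec _ hαn
  have l1 : (intMinpoly α).leadingCoeff ≠ 0 := leadingCoeff_ne_zero.2 p1.ne_zero
  have l2 : (intMinpoly (α ^ n)).leadingCoeff ≠ 0 := leadingCoeff_ne_zero.2 p2.ne_zero
  rw [aroots_pow hα htf hn, Multiset.map_map] at e2
  have hlc := lc_pow p1 p2 l1 l2 hn _ e1 e2
  have r1 := congrArg roots e1
  have r2 := congrArg roots e2
  rw [roots_C_mul _ (by exact_mod_cast l1), roots_multiset_prod_X_sub_C] at r1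
  rw [roots_C_mul _ (by exact_mod_cast l2)] at r2
  have r3 : (((minpoly ℚ α).aroots ℂ).map ((fun s : ℂ => (X - C s : ℂ[X])) ∘ (· ^ n))) =
    ((((minpoly ℚ α).aroots ℂ).map (· ^ n)).map (fun s : ℂ => (X - C s : ℂ[X]))) := by
      rw [Multiset.map_map]
  rw [r3, roots_multiset_prod_X_sub_C] at r2
  unfold mahlerM
  rw [r1, r2, hlc, Multiset.map_map, mul_pow, ← Multiset.prod_map_pow, Nat.cast_pow]
  congr 2
  apply Multiset.map_congr rfl
  intro z _
  simp only [Function.comp, norm_pow]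
  rcases le_total 1 ‖z‖ with h | h
  · rw [max_eq_right h, max_eq_right (one_le_pow₀ h)]
  · rw [max_eq_left h, max_eq_left (pow_le_one₀ (norm_nonneg _) h), one_pow]
end

section
/- If α ≠ ±1 is a torsion-free algebraic number and M^k(α) = α^n for some positive integers k and n with n ≥ 2, then α is a wandering point for the Mahler measure M, i.e., the forward orbit {M^m(α) : m ≥ 0} is infinite. -/
open Polynomial

theorem exists_algEquiv_of_card {R K L : Type} [Field R] [Field K] [Field L]
    [Algebra R K] [Algebra R L] [IsAlgClosed K] [IsAlgClosed L]
    (hR : Cardinal.mk R ≤ Cardinal.aleph0) (hK : Cardinal.aleph0 < Cardinal.mk K)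
    (hKL : Cardinal.mk K = Cardinal.mk L) : Nonempty (K ≃ₐ[R] L) := by
  obtain ⟨s, hs⟩ := exists_isTranscendenceBasis R K
  obtain ⟨t, ht⟩ := exists_isTranscendenceBasis R L
  have hcs := IsAlgClosed.cardinal_eq_cardinal_transcendence_basis_of_aleph0_lt' _ hs hR hK
  have hct := IsAlgClosed.cardinal_eq_cardinal_transcendence_basis_of_aleph0_lt' _ ht hR (hKL ▸ hK)
  obtain ⟨e⟩ := Cardinal.eq.1 (hcs.symm.trans (hKL.trans hct))
  let := IsAlgClosed.isAlgClosure_of_transcendence_basis _ hs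
  let := IsAlgClosed.isAlgClosure_of_transcendence_basis _ ht
  let E : Algebra.adjoin R (Set.range ((↑) : s → K)) ≃ₐ[R]
      Algebra.adjoin R (Set.range ((↑) : t → L)) :=
    hs.1.aevalEquiv.symm.trans ((MvPolynomial.renameEquiv R e).trans ht.1.aevalEquiv)
  refine ⟨AlgEquiv.ofRingEquiv (f := IsAlgClosure.equivOfEquiv K L E.toRingEquiv) ?_⟩
  intro r
  have h := IsAlgClosure.equivOfEquiv_algebraMap K L E.toRingEquiv (algebraMap R _ r)
  rw [← IsScalarTower.algebraMap_apply] at h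
  rw [h]
  have : E.toRingEquiv (algebraMap R _ r) = algebraMap R _ r := E.commutes r
  rw [this, ← IsScalarTower.algebraMap_apply]

theorem exists_sigma {α β : ℂ} (hα : IsAlgebraic ℚ α) (hβ : aeval β (minpoly ℚ α) = 0) :
    ∃ σ : ℂ ≃ₐ[ℚ] ℂ, σ α = β := by
  have hint : IsIntegral ℚ α := hα.isIntegral
  let φ : IntermediateField.adjoin ℚ {α} →ₐ[ℚ] ℂ :=
    (IntermediateField.adjoin.powerBasis hint).lift β (by
      simpa [IntermediateField.adjoin.powerBasis_gen, IntermediateField.minpoly_gen] using hβ)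
  have hφ : φ (IntermediateField.AdjoinSimple.gen ℚ α) = β := by
    have := (IntermediateField.adjoin.powerBasis hint).lift_gen β (by
      simpa [IntermediateField.adjoin.powerBasis_gen, IntermediateField.minpoly_gen] using hβ)
    exact this
  have hcount : Cardinal.mk (IntermediateField.adjoin ℚ {α}) ≤ Cardinal.aleph0 := by
    have : FiniteDimensional ℚ (IntermediateField.adjoin ℚ {α}) :=
      IntermediateField.adjoin.finiteDimensional hint
    have := Algebra.IsAlgebraic.cardinalMk_le_max ℚ (IntermediateField.adjoin ℚ {α})
    simpa using this
  have hC : Cardinal.aleph0 < Cardinal.mk ℂ := by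
    rw [Cardinal.mk_complex]; exact Cardinal.aleph0_lt_continuum
  obtain ⟨τ⟩ := @exists_algEquiv_of_card (IntermediateField.adjoin ℚ {α}) ℂ ℂ _ _ _ _
    φ.toRingHom.toAlgebra _ _ hcount hC rfl
  refine ⟨AlgEquiv.ofRingEquiv (f := @AlgEquiv.toRingEquiv _ ℂ ℂ _ _ _ _ (_) τ) (fun r => by simp), ?_⟩
  have := @AlgEquiv.commutes _ ℂ ℂ _ _ _ _ (_) τ (IntermediateField.AdjoinSimple.gen ℚ α)
  exact this.trans hφ

theorem intMinpoly_isPrimitive (α : ℂ)  : (intMinpoly α).IsPrimitive := isPrimitive_primPart _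

theorem intMinpoly_map_Q {α : ℂ} (hα : IsAlgebraic ℚ α)  : ∃ c : ℚ, c ≠ 0 ∧
    (intMinpoly α).map (algebraMap ℤ ℚ) = C c * minpoly ℚ α := by
  have hm : minpoly ℚ α ≠ 0 := minpoly.ne_zero hα.isIntegral
  set N := IsLocalization.integerNormalization (nonZeroDivisors ℤ) (minpoly ℚ α) with hN
  obtain ⟨b, hb, hb2⟩ := IsLocalization.integerNormalization_spec (nonZeroDivisors ℤ) (minpoly ℚ α)
  have hN0 : N ≠ 0 := fun h => hm ((IsFractionRing.integerNormalization_eq_zero_iff).1 h)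
  have hc : (N.content : ℚ) ≠ 0 := by
    simpa [content_eq_zero_iff] using hN0
  have hb0 : (b : ℚ) ≠ 0 := by
    simpa using nonZeroDivisors.ne_zero hb
  have h1 : C (N.content : ℚ) * (intMinpoly α).map (algebraMap ℤ ℚ) = C (b : ℚ) * minpoly ℚ α := by
    have h2 : N.map (algebraMap ℤ ℚ) = C (N.content : ℚ) * (intMinpoly α).map (algebraMap ℤ ℚ) := by
      conv_lhs => rw [N.eq_C_content_mul_primPart]
      simp [intMinpoly, hN]
    rw [← h2, hb2]
    simp
  refine ⟨(N.content : ℚ)⁻¹ * b, mul_ne_zero (inv_ne_zero hc) hb0, ?_⟩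
  rw [C_mul, mul_assoc, ← h1, ← mul_assoc, ← C_mul, inv_mul_cancel₀ hc]; simp

theorem intMinpoly_ne_zero {α : ℂ} (hα : IsAlgebraic ℚ α)  : intMinpoly α ≠ 0 := by
  obtain ⟨c, hc, h⟩ := intMinpoly_map_Q hα
  intro h0
  rw [h0] at h
  have hm : minpoly ℚ α ≠ 0 := minpoly.ne_zero hα.isIntegral
  simp [hc, hm] at h

theorem intMinpoly_roots {α : ℂ} (hα : IsAlgebraic ℚ α)  : ((intMinpoly α).map (Int.castRingHom ℂ)).roots
    = ((minpoly ℚ α).map (algebraMap ℚ ℂ)).roots := by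
  obtain ⟨c, hc, h⟩ := intMinpoly_map_Q hα
  have h2 : (intMinpoly α).map (Int.castRingHom ℂ) =
      C (c : ℂ) * (minpoly ℚ α).map (algebraMap ℚ ℂ) := by
    have := congrArg (Polynomial.map (algebraMap ℚ ℂ)) h
    rw [Polynomial.map_map] at this
    rw [show Int.castRingHom ℂ = (algebraMap ℚ ℂ).comp (algebraMap ℤ ℚ) from RingHom.ext_int _ _, this]
    simp
  rw [h2, roots_C_mul _ (by exact_mod_cast hc)]

theorem intMinpoly_roots_nodup {α : ℂ} (hα : IsAlgebraic ℚ α)  : ((intMinpoly α).map (Int.castRingHom ℂ)).roots.Nodup := by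
  rw [intMinpoly_roots hα]
  exact nodup_roots ((minpoly.irreducible hα.isIntegral).separable.map)

theorem mem_intMinpoly_roots {α : ℂ} (hα : IsAlgebraic ℚ α)  {z : ℂ} : z ∈ ((intMinpoly α).map (Int.castRingHom ℂ)).roots ↔
    ∃ σ : ℂ ≃ₐ[ℚ] ℂ, σ α = z := by
  have hm : minpoly ℚ α ≠ 0 := minpoly.ne_zero hα.isIntegral
  rw [intMinpoly_roots hα, mem_roots (Polynomial.map_ne_zero hm), IsRoot.def, eval_map_algebraMap]
  constructor
  · exact exists_sigma hα
  · rintro ⟨σ, rfl⟩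
    have := aeval_algHom_apply (σ : ℂ →ₐ[ℚ] ℂ) α (minpoly ℚ α)
    rw [minpoly.aeval, map_zero] at this
    exact this

theorem intMinpoly_factor (α : ℂ)  : (intMinpoly α).map (Int.castRingHom ℂ) =
    C ((intMinpoly α).leadingCoeff : ℂ) *
      ((((intMinpoly α).map (Int.castRingHom ℂ)).roots).map (fun z => X - C z)).prod := by
  conv_lhs => rw [(IsAlgClosed.splits ((intMinpoly α).map (Int.castRingHom ℂ))).eq_prod_roots]
  rw [leadingCoeff_map_of_injective (RingHom.injective_int _)]
  simp

theorem dvd_of_contentIdeal {R : Type*} [CommRing R] {h : R[X]} {b c : R}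
    (hh : h.contentIdeal = ⊤) (hd : ∀ i, b ∣ c * h.coeff i) : b ∣ c := by
  have key : h.contentIdeal ≤ Submodule.comap (LinearMap.mulLeft R c) (Ideal.span {b}) := by
    rw [contentIdeal_def, Ideal.span_le]
    intro x hx
    rw [Finset.mem_coe, mem_coeffs_iff] at hx
    obtain ⟨n, _, rfl⟩ := hx
    exact Ideal.mem_span_singleton.2 (hd n)
  have h1 : (1 : R) ∈ h.contentIdeal := by rw [hh]; trivial
  have := key h1
  simpa [Ideal.mem_span_singleton] using this

theorem contentIdeal_scaleRoots {R : Type*} [CommRing R] {h : R[X]} {u : R} (hu : IsUnit u)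
    (hh : h.contentIdeal = ⊤) : (h.scaleRoots u).contentIdeal = ⊤ := by
  rw [eq_top_iff, ← hh, contentIdeal_def, Ideal.span_le]
  intro x hx
  rw [Finset.mem_coe, mem_coeffs_iff] at hx
  obtain ⟨n, _, rfl⟩ := hx
  have h1 := coeff_mem_contentIdeal (h.scaleRoots u) n
  rw [coeff_scaleRoots] at h1
  exact (Ideal.mul_unit_mem_iff_mem _ (hu.pow _)).1 h1

theorem contentIdeal_prod {R ι : Type*} [CommRing R] (s : Finset ι) (h : ι → R[X])
    (hh : ∀ i ∈ s, (h i).contentIdeal = ⊤) : (∏ i ∈ s, h i).contentIdeal = ⊤ := by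
  classical
  induction s using Finset.induction_on with
  | empty => simp
  | insert a s ha ih =>
    rw [Finset.prod_insert ha]
    exact contentIdeal_mul_eq_top_of_contentIdeal_eq_top (hh a (by simp))
      (ih fun i hi => hh i (by simp [hi]))

theorem scaleRoots_multiset_prod (s : Multiset ℂ) (u : ℂ) :
    ((s.map (fun z => X - C z)).prod).scaleRoots u = (s.map (fun z => X - C (u * z))).prod := by
  induction s using Multiset.induction_on with
  | empty => simp
  | cons a s ih =>
    simp only [Multiset.map_cons, Multiset.prod_cons]
    rw [mul_scaleRoots_of_noZeroDivisors, ih, X_sub_C_scaleRoots, mul_comm a u]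

theorem expand_eq_prod (s : Multiset ℂ) {n : ℕ} (hn : 0 < n) {ζ : ℂ} (hζ : IsPrimitiveRoot ζ n) :
    expand ℂ n ((s.map (fun z => X - C (z ^ n))).prod) =
      ∏ i ∈ Finset.range n, (s.map (fun z => X - C (ζ ^ i * z))).prod := by
  induction s using Multiset.induction_on with
  | empty => simp
  | cons a s ih =>
    simp only [Multiset.map_cons, Multiset.prod_cons]
    rw [map_mul, ih, Finset.prod_mul_distrib, ← X_pow_sub_C_eq_prod hζ hn rfl]
    simp

theorem contentIdeal_expand {R : Type*} [CommRing R] {h : R[X]} {n : ℕ} (hn : 0 < n)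
    (hh : h.contentIdeal = ⊤) : (expand R n h).contentIdeal = ⊤ := by
  rw [eq_top_iff, ← hh, contentIdeal_def, Ideal.span_le]
  intro x hx
  rw [Finset.mem_coe, mem_coeffs_iff] at hx
  obtain ⟨m, _, rfl⟩ := hx
  have h1 := coeff_mem_contentIdeal (expand R n h) (m * n)
  rwa [coeff_expand_mul hn] at h1

theorem int_dvd_of_integral {a b : ℤ} {r : ℂ} (hr : IsIntegral ℤ r) (h : (a : ℂ) = b * r) :
    b ∣ a := by
  by_cases hb : b = 0
  · subst hb
    simp at h
    simp [h]
  have hr' : r = algebraMap ℚ ℂ ((a : ℚ) / b) := by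
    have : (b : ℂ) ≠ 0 := by exact_mod_cast hb
    simp
    field_simp
    rw [h, mul_comm]
  rw [hr', isIntegral_algebraMap_iff (algebraMap ℚ ℂ).injective] at hr
  obtain ⟨y, hy⟩ := IsIntegrallyClosed.isIntegral_iff.1 hr
  refine ⟨y, ?_⟩
  have hb' : (b : ℚ) ≠ 0 := by exact_mod_cast hb
  have : (y : ℚ) = a / b := by simpa using hy
  field_simp at this
  have h2 : y * b = a := by exact_mod_cast this
  rw [← h2, mul_comm]

/-- Leading coefficients of primitive integer polynomials with roots related by `n`-th powers. -/
theorem natAbs_leadingCoeff_eq {f g : ℤ[X]} (hf : f.IsPrimitive) (hg : g.IsPrimitive)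
    {n : ℕ} (hn : 0 < n) (s : Multiset ℂ)
    (hfs : f.map (Int.castRingHom ℂ) =
      C (f.leadingCoeff : ℂ) * (s.map (fun z => X - C z)).prod)
    (hgs : g.map (Int.castRingHom ℂ) =
      C (g.leadingCoeff : ℂ) * (s.map (fun z => X - C (z ^ n))).prod) :
    g.leadingCoeff.natAbs = f.leadingCoeff.natAbs ^ n := by
  let R := integralClosure ℤ ℂ
  have hinj : Function.Injective (algebraMap R ℂ) := Subtype.val_injective
  have hprimC : IsPrimitiveRoot (Complex.exp (2 * Real.pi * Complex.I / n)) n :=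
    Complex.isPrimitiveRoot_exp n hn.ne'
  set z := Complex.exp (2 * Real.pi * Complex.I / n) with hz
  let ζ : R := ⟨z, hprimC.isIntegral hn⟩
  have hζ : IsPrimitiveRoot ζ n := IsPrimitiveRoot.of_map_of_injective (f := algebraMap R ℂ) hprimC hinj
  have hff : (f.map (algebraMap ℤ R)).contentIdeal = ⊤ := by
    rw [contentIdeal_map_eq_map_contentIdeal, (isPrimitive_iff_contentIdeal_eq_top f).1 hf,
      Ideal.map_top]
  have hgg : (g.map (algebraMap ℤ R)).contentIdeal = ⊤ := by
    rw [contentIdeal_map_eq_map_contentIdeal, (isPrimitive_iff_contentIdeal_eq_top g).1 hg,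
      Ideal.map_top]
  set F : R[X] := ∏ i ∈ Finset.range n, (f.map (algebraMap ℤ R)).scaleRoots (ζ ^ i) with hF
  set H : R[X] := expand R n (g.map (algebraMap ℤ R)) with hH
  have hFc : F.contentIdeal = ⊤ := contentIdeal_prod _ _ fun i _ =>
    contentIdeal_scaleRoots ((hζ.isUnit hn.ne').pow i) hff
  have hHc : H.contentIdeal = ⊤ := contentIdeal_expand hn hgg
  have hf0 : f ≠ 0 := hf.ne_zero
  have hcomp : (algebraMap R ℂ).comp (algebraMap ℤ R) = Int.castRingHom ℂ := RingHom.ext_int _ _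
  have hmapF : F.map (algebraMap R ℂ) = C ((f.leadingCoeff : ℂ) ^ n) *
      ∏ i ∈ Finset.range n, (s.map (fun w => X - C (z ^ i * w))).prod := by
    rw [hF, Polynomial.map_prod, C_pow]
    have : ∀ i ∈ Finset.range n, ((f.map (algebraMap ℤ R)).scaleRoots (ζ ^ i)).map (algebraMap R ℂ)
        = C (f.leadingCoeff : ℂ) * (s.map (fun w => X - C (z ^ i * w))).prod := by
      intro i _
      rw [map_scaleRoots, Polynomial.map_map, hcomp, hfs, mul_scaleRoots_of_noZeroDivisors,
        scaleRoots_C, scaleRoots_multiset_prod, map_pow]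
      · rfl
      · rw [leadingCoeff_map_of_injective (RingHom.injective_int _)]
        simpa using hf0
    rw [Finset.prod_congr rfl this, Finset.prod_mul_distrib]
    simp
  have hmapH : H.map (algebraMap R ℂ) = C (g.leadingCoeff : ℂ) *
      ∏ i ∈ Finset.range n, (s.map (fun w => X - C (z ^ i * w))).prod := by
    rw [hH, map_expand, Polynomial.map_map, hcomp, hgs, map_mul, expand_C, expand_eq_prod s hn hprimC]
  have hmain : C ((f.leadingCoeff : R) ^ n) * H = C (g.leadingCoeff : R) * F := by
    apply Polynomial.map_injective _ hinj
    rw [Polynomial.map_mul, Polynomial.map_mul, hmapF, hmapH]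
    have hi : ∀ m : ℤ, algebraMap R ℂ (m : R) = (m : ℂ) := fun m => map_intCast _ m
    rw [Polynomial.map_C, Polynomial.map_C, map_pow, hi, hi]
    exact mul_left_comm _ _ _
  have hcoeff : ∀ i, (f.leadingCoeff : R) ^ n * H.coeff i = (g.leadingCoeff : R) * F.coeff i := by
    intro i
    have := congrArg (fun p => coeff p i) hmain
    simpa only [coeff_C_mul] using this
  have d1 : (g.leadingCoeff : R) ∣ (f.leadingCoeff : R) ^ n :=
    dvd_of_contentIdeal hHc fun i => ⟨_, hcoeff i⟩
  have d2 : (f.leadingCoeff : R) ^ n ∣ (g.leadingCoeff : R) :=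
    dvd_of_contentIdeal hFc fun i => ⟨_, (hcoeff i).symm⟩
  have e1 : g.leadingCoeff ∣ f.leadingCoeff ^ n := by
    obtain ⟨r, hr⟩ := d1
    refine int_dvd_of_integral (r := (r : ℂ)) r.2 ?_
    have := congrArg (algebraMap R ℂ) hr
    simp only [map_mul, map_pow, map_intCast] at this
    push_cast
    exact this
  have e2 : f.leadingCoeff ^ n ∣ g.leadingCoeff := by
    obtain ⟨r, hr⟩ := d2
    refine int_dvd_of_integral (r := (r : ℂ)) r.2 ?_
    have := congrArg (algebraMap R ℂ) hr
    simp only [map_mul, map_pow, map_intCast] at this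
    push_cast
    exact this
  rw [← Int.natAbs_pow]
  exact Nat.dvd_antisymm (Int.natAbs_dvd_natAbs.2 e1) (Int.natAbs_dvd_natAbs.2 e2)

theorem intMinpoly_pow_roots {α : ℂ} (hα : IsAlgebraic ℚ α) (h0 : α ≠ 0) (htf : TorsionFree α)
    {n : ℕ} (hn : 0 < n) :
    ((intMinpoly (α ^ n)).map (Int.castRingHom ℂ)).roots =
      (((intMinpoly α).map (Int.castRingHom ℂ)).roots).map (fun z => z ^ n) := by
  refine (Multiset.Nodup.ext (intMinpoly_roots_nodup (hα.pow n)) ?_).2 ?_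
  · refine Multiset.Nodup.map_on ?_ (intMinpoly_roots_nodup hα)
    intro x hx y hy hxy
    obtain ⟨σ, rfl⟩ := (mem_intMinpoly_roots hα).1 hx
    obtain ⟨τ, rfl⟩ := (mem_intMinpoly_roots hα).1 hy
    by_contra hne
    have hρ : (τ.trans σ.symm) α ≠ α := by
      intro h
      apply hne
      have : σ ((τ.trans σ.symm) α) = σ α := by rw [h]
      simpa using this.symm
    apply htf (τ.trans σ.symm) hρ n hn
    have h2 : α ^ n = ((τ.trans σ.symm) α) ^ n := by
      apply σ.injective
      simpa using hxy
    rw [div_pow, ← h2, div_self (pow_ne_zero _ h0)]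
  · intro z
    rw [mem_intMinpoly_roots (hα.pow n), Multiset.mem_map]
    constructor
    · rintro ⟨σ, rfl⟩
      exact ⟨σ α, (mem_intMinpoly_roots hα).2 ⟨σ, rfl⟩, by simp⟩
    · rintro ⟨y, hy, rfl⟩
      obtain ⟨σ, rfl⟩ := (mem_intMinpoly_roots hα).1 hy
      exact ⟨σ, by simp⟩

theorem mahlerM_pow {α : ℂ} (hα : IsAlgebraic ℚ α) (h0 : α ≠ 0) (htf : TorsionFree α)
    {n : ℕ} (hn : 0 < n) : mahlerM (α ^ n) = mahlerM α ^ n := by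
  have hr := intMinpoly_pow_roots hα h0 htf hn
  have hl := natAbs_leadingCoeff_eq (intMinpoly_isPrimitive α) (intMinpoly_isPrimitive (α ^ n)) hn
    _ (intMinpoly_factor α) (by
      have := intMinpoly_factor (α ^ n)
      rw [hr, Multiset.map_map] at this
      exact this)
  unfold mahlerM
  rw [hr, hl, Multiset.map_map, mul_pow, ← Multiset.prod_map_pow]
  push_cast
  congr 2
  apply Multiset.map_congr rfl
  intro z _
  simp only [Function.comp_apply, norm_pow]
  rcases le_total 1 ‖z‖ with h | h
  · rw [max_eq_right h, max_eq_right (one_le_pow₀ h)]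
  · rw [max_eq_left h, max_eq_left (pow_le_one₀ (norm_nonneg _) h), one_pow]

open Classical in
/-- The conjugates outside the closed unit disc. -/
noncomputable def bigConj (α : ℂ) : Finset ℂ :=
  ((intMinpoly α).map (Int.castRingHom ℂ)).roots.toFinset.filter (fun z => 1 < ‖z‖)

theorem mem_bigConj {α : ℂ} (hα : IsAlgebraic ℚ α) {z : ℂ} :
    z ∈ bigConj α ↔ (∃ σ : ℂ ≃ₐ[ℚ] ℂ, σ α = z) ∧ 1 < ‖z‖ := by
  classical
  rw [bigConj, Finset.mem_filter, Multiset.mem_toFinset, mem_intMinpoly_roots hα]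

theorem mahlerM_eq {α : ℂ} (hα : IsAlgebraic ℚ α) :
    mahlerM α = ((intMinpoly α).leadingCoeff.natAbs : ℝ) * ∏ z ∈ bigConj α, ‖z‖ := by
  classical
  unfold mahlerM bigConj
  rw [Finset.prod_filter, Finset.prod, Multiset.toFinset_val,
    (intMinpoly_roots_nodup hα).dedup]
  congr 2
  apply Multiset.map_congr rfl
  intro z _
  split_ifs with h
  · exact max_eq_right h.le
  · exact max_eq_left (not_lt.1 h)

noncomputable def conjQ : ℂ ≃ₐ[ℚ] ℂ := Complex.conjAe.restrictScalars ℚ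

theorem conjQ_apply (z : ℂ) : conjQ z = (starRingEnd ℂ) z := rfl

/-- `M(α)` is a rational multiple of the product of the conjugates outside the unit disc. -/
theorem exists_mahlerC_eq {α : ℂ} (hα : IsAlgebraic ℚ α) :
    ∃ c : ℚ, c ≠ 0 ∧ mahlerC α = algebraMap ℚ ℂ c * ∏ z ∈ bigConj α, z := by
  have hreal : (starRingEnd ℂ) (∏ z ∈ bigConj α, z) = ∏ z ∈ bigConj α, z := by
    rw [map_prod]
    refine Finset.prod_bij' (fun z _ => (starRingEnd ℂ) z) (fun z _ => (starRingEnd ℂ) z)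
      ?_ ?_ (by simp) (by simp) (by simp)
    all_goals
      intro z hz
      obtain ⟨⟨σ, rfl⟩, h⟩ := (mem_bigConj hα).1 hz
      exact (mem_bigConj hα).2 ⟨⟨σ.trans conjQ, rfl⟩, by simpa using h⟩
  obtain ⟨r, hr⟩ := Complex.conj_eq_iff_real.1 hreal
  have hnorm : ∏ z ∈ bigConj α, ‖z‖ = |r| := by
    rw [← norm_prod, hr]; simp
  have hlc : (intMinpoly α).leadingCoeff ≠ 0 := leadingCoeff_ne_zero.2 (intMinpoly_ne_zero hα)
  have hlc' : ((intMinpoly α).leadingCoeff.natAbs : ℚ) ≠ 0 := by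
    exact_mod_cast Int.natAbs_ne_zero.2 hlc
  rw [hr, mahlerC, mahlerM_eq hα, hnorm]
  generalize (intMinpoly α).leadingCoeff.natAbs = a at hlc' ⊢
  rcases abs_choice r with h | h
  · exact ⟨a, hlc', by rw [h]; simp⟩
  · exact ⟨-a, neg_ne_zero.2 hlc', by rw [h]; simp⟩

theorem mahlerC_isAlgebraic {α : ℂ} (hα : IsAlgebraic ℚ α) : IsAlgebraic ℚ (mahlerC α) := by
  obtain ⟨c, _, h⟩ := exists_mahlerC_eq hα
  rw [h]
  refine (isAlgebraic_algebraMap c).mul ?_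
  have : ∀ z ∈ bigConj α, IsIntegral ℚ z := by
    intro z hz
    obtain ⟨⟨σ, rfl⟩, _⟩ := (mem_bigConj hα).1 hz
    exact hα.isIntegral.map σ
  exact (IsIntegral.prod _ this).isAlgebraic

theorem mahlerC_ne_zero {α : ℂ} (hα : IsAlgebraic ℚ α) : mahlerC α ≠ 0 := by
  obtain ⟨c, hc, h⟩ := exists_mahlerC_eq hα
  rw [h]
  refine mul_ne_zero (by simpa using hc) (Finset.prod_ne_zero_iff.2 fun z hz => ?_)
  have := ((mem_bigConj hα).1 hz).2
  rintro rfl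
  simp at this
  linarith

theorem mahlerC_torsionFree {α : ℂ} (hα : IsAlgebraic ℚ α) : TorsionFree (mahlerC α) := by
  classical
  intro σ hσ n hn hpow
  obtain ⟨c, hc, h⟩ := exists_mahlerC_eq hα
  set S := bigConj α with hS
  set T := S.image σ with hT
  have hc0 : algebraMap ℚ ℂ c ≠ 0 := by simpa using hc
  have hσM : σ (mahlerC α) = algebraMap ℚ ℂ c * ∏ z ∈ T, z := by
    rw [h, map_mul, AlgEquiv.commutes, map_prod, hT,
      Finset.prod_image (fun x _ y _ hxy => σ.injective hxy)]
  have hne : T ≠ S := by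
    intro hTS
    apply hσ
    rw [hσM, hTS, ← h]
  have hcard : T.card = S.card := Finset.card_image_of_injective _ σ.injective
  have hnot : ¬ S ⊆ T := fun hsub => hne (Finset.eq_of_subset_of_card_le hsub hcard.le).symm
  obtain ⟨z0, hz0S, hz0T⟩ := Finset.not_subset.1 hnot
  have hSbig : ∀ z ∈ S, 1 < ‖z‖ := fun z hz => ((mem_bigConj hα).1 hz).2
  have hTsmall : ∀ z ∈ T \ S, ‖z‖ ≤ 1 := by
    intro z hz
    obtain ⟨hzT, hzS⟩ := Finset.mem_sdiff.1 hz
    by_contra hlt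
    apply hzS
    obtain ⟨w, hw, rfl⟩ := Finset.mem_image.1 hzT
    obtain ⟨⟨τ, rfl⟩, _⟩ := (mem_bigConj hα).1 hw
    exact (mem_bigConj hα).2 ⟨⟨τ.trans σ, rfl⟩, not_le.1 hlt⟩
  have e1 : ∏ z ∈ T, ‖z‖ ≤ ∏ z ∈ T ∩ S, ‖z‖ := by
    rw [← Finset.prod_inter_mul_prod_sdiff T S]
    exact mul_le_of_le_one_right (Finset.prod_nonneg fun _ _ => norm_nonneg _)
      (Finset.prod_le_one (fun _ _ => norm_nonneg _) hTsmall)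
  have e2 : ∏ z ∈ T ∩ S, ‖z‖ < ∏ z ∈ S, ‖z‖ := by
    rw [← Finset.prod_inter_mul_prod_sdiff S T, Finset.inter_comm T S]
    refine lt_mul_of_one_lt_right (Finset.prod_pos fun z hz =>
      lt_trans one_pos (hSbig z (Finset.mem_inter.1 hz).1)) ?_
    have hz : z0 ∈ S \ T := Finset.mem_sdiff.2 ⟨hz0S, hz0T⟩
    rw [← Finset.mul_prod_erase _ _ hz]
    refine one_lt_mul_of_lt_of_le (hSbig z0 hz0S) ?_
    exact Finset.prod_induction _ (fun x => 1 ≤ x)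
      (fun _ _ => one_le_mul_of_one_le_of_one_le) le_rfl fun z hz =>
      (hSbig z (Finset.mem_sdiff.1 (Finset.mem_of_mem_erase hz)).1).le
  have hlt : ‖σ (mahlerC α)‖ < ‖mahlerC α‖ := by
    rw [hσM, h, norm_mul, norm_mul, norm_prod, norm_prod]
    exact mul_lt_mul_of_pos_left (e1.trans_lt e2) (norm_pos_iff.2 hc0)
  have hpos : 0 < ‖σ (mahlerC α)‖ := by
    rw [norm_pos_iff]
    exact (map_ne_zero σ).2 (mahlerC_ne_zero hα)
  have hn1 : ‖(mahlerC α / σ (mahlerC α)) ^ n‖ = 1 := by rw [hpow]; simp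
  rw [norm_pow, norm_div] at hn1
  exact absurd hn1 (one_lt_pow₀ ((one_lt_div hpos).2 hlt) hn.ne').ne'

theorem mahlerC_pow {α : ℂ} (hα : IsAlgebraic ℚ α) (h0 : α ≠ 0) (htf : TorsionFree α)
    {n : ℕ} (hn : 0 < n) : mahlerC (α ^ n) = mahlerC α ^ n := by
  rw [mahlerC, mahlerC, mahlerM_pow hα h0 htf hn]
  push_cast
  rfl

theorem mahlerC_iterate_pow (i : ℕ) {n : ℕ} (hn : 0 < n) :
    ∀ {α : ℂ}, IsAlgebraic ℚ α → α ≠ 0 → TorsionFree α →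
      mahlerC^[i] (α ^ n) = (mahlerC^[i] α) ^ n := by
  induction i with
  | zero => intro α _ _ _; rfl
  | succ i ih =>
    intro α hα h0 htf
    rw [Function.iterate_succ_apply, Function.iterate_succ_apply, mahlerC_pow hα h0 htf hn]
    exact ih (mahlerC_isAlgebraic hα) (mahlerC_ne_zero hα) (mahlerC_torsionFree hα)

theorem mahlerC_iterate_ne_zero (k : ℕ) : ∀ {α : ℂ}, IsAlgebraic ℚ α → mahlerC^[k + 1] α ≠ 0 := by
  induction k with
  | zero => intro α hα; exact mahlerC_ne_zero hα
  | succ i ih =>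
    intro α hα
    rw [Function.iterate_succ_apply]
    exact ih (mahlerC_isAlgebraic hα)

theorem not_rootOfUnity {α : ℂ} (h0 : α ≠ 0) (h1 : α ≠ 1) (h2 : α ≠ -1) (htf : TorsionFree α)
    {N : ℕ} (hN : 0 < N) : α ^ N ≠ 1 := by
  intro h
  have hfix : conjQ α = α := by
    by_contra hne
    apply htf conjQ hne N hN
    rw [div_pow, ← map_pow, h, map_one, div_one]
  obtain ⟨r, hr⟩ := Complex.conj_eq_iff_real.1 hfix
  have hn : ‖α‖ = 1 := Complex.norm_eq_one_of_pow_eq_one h hN.ne'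
  rw [hr, Complex.norm_real, Real.norm_eq_abs] at hn
  rcases (abs_eq zero_le_one).1 hn with h' | h'
  · exact h1 (by rw [hr, h']; simp)
  · exact h2 (by rw [hr, h']; simp)

theorem wandering_of_torsionFree_iterate_eq_pow (α : ℂ) (hα : IsAlgebraic ℚ α)
    (h1 : α ≠ 1) (h2 : α ≠ -1) (htf : TorsionFree α)
    (k n : ℕ) (hk : 0 < k) (hn : 2 ≤ n)
    (heq : mahlerC^[k] α = α ^ n) :
    (Set.range fun m : ℕ => mahlerC^[m] α).Infinite := by
  have hn0 : 0 < n := by omega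
  have h0 : α ≠ 0 := by
    rintro rfl
    obtain ⟨j, rfl⟩ := Nat.exists_eq_succ_of_ne_zero hk.ne'
    apply mahlerC_iterate_ne_zero j hα
    rw [heq, zero_pow hn0.ne']
  have hiter : ∀ j : ℕ, mahlerC^[k * j] α = α ^ (n ^ j) := by
    intro j
    induction j with
    | zero => simp
    | succ j ih =>
      rw [Nat.mul_succ, Nat.add_comm, Function.iterate_add_apply, ih,
        mahlerC_iterate_pow k (pow_pos hn0 j) hα h0 htf, heq, ← pow_mul, pow_succ', ]
  have hinj : Function.Injective fun j : ℕ => α ^ (n ^ j) := by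
    have key : ∀ i j : ℕ, i < j → α ^ (n ^ i) ≠ α ^ (n ^ j) := by
      intro i j hij he
      have hlt : n ^ i < n ^ j := Nat.pow_lt_pow_right (by omega) hij
      apply not_rootOfUnity h0 h1 h2 htf (Nat.sub_pos_of_lt hlt)
      rw [pow_sub₀ _ h0 hlt.le, he, mul_inv_cancel₀ (pow_ne_zero _ h0)]
    intro i j hij
    rcases lt_trichotomy i j with h | h | h
    · exact absurd hij (key i j h)
    · exact h
    · exact absurd hij.symm (key j i h)
  refine (Set.infinite_range_of_injective hinj).mono ?_
  rintro _ ⟨j, rfl⟩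
  exact ⟨k * j, hiter j⟩
end

section
/- If K/ℚ is a totally imaginary quartic number field, then every element of K is preperiodic under iteration of the Mahler measure M. -/
open Polynomial

theorem im_spec {α : ℂ} (h : IsIntegral ℚ α) : (intMinpoly α).IsPrimitive ∧
    ∃ c : ℚ, c ≠ 0 ∧ (intMinpoly α).map (Int.castRingHom ℚ) = C c * minpoly ℚ α := by
  refine ⟨isPrimitive_primPart _, ?_⟩
  obtain ⟨b, hb, hm⟩ := IsLocalization.integerNormalization_spec (nonZeroDivisors ℤ) (minpoly ℚ α)
  have hb0 : b ≠ 0 := nonZeroDivisors.ne_zero hb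
  set q := IsLocalization.integerNormalization (nonZeroDivisors ℤ) (minpoly ℚ α) with hq
  have hq0 : q ≠ 0 := by
    intro h0
    rw [h0, Polynomial.map_zero] at hm
    have := minpoly.ne_zero h
    rcases smul_eq_zero.mp hm.symm with h | h
    · exact hb0 h
    · exact this h
  have hc0 : q.content ≠ 0 := by rwa [Ne, content_eq_zero_iff]
  have h1 : q.map (Int.castRingHom ℚ) = C (q.content : ℚ) * (q.primPart).map (Int.castRingHom ℚ) := by
    conv_lhs => rw [q.eq_C_content_mul_primPart]
    simp
  have h2 : q.map (Int.castRingHom ℚ) = C (b : ℚ) * minpoly ℚ α := by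
    have : (algebraMap ℤ ℚ) = Int.castRingHom ℚ := rfl
    rw [← this, hm, ← Int.cast_smul_eq_zsmul ℚ, smul_eq_C_mul]
  refine ⟨(q.content : ℚ)⁻¹ * b, by positivity, ?_⟩
  have h3 : C ((q.content : ℚ)⁻¹) * C (q.content : ℚ) = 1 := by
    rw [← C_mul, inv_mul_cancel₀ (by exact_mod_cast hc0), C_1]
  change q.primPart.map _ = _
  rw [C_mul, mul_assoc, ← h2, h1, ← mul_assoc, h3, one_mul]

noncomputable def cr (α : ℂ) : Multiset ℂ := (minpoly ℚ α).aroots ℂ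

noncomputable def lc (α : ℂ) : ℕ := (intMinpoly α).leadingCoeff.natAbs

theorem im_ne {α : ℂ} (h : IsIntegral ℚ α) : intMinpoly α ≠ 0 := (im_spec h).1.ne_zero

theorem lc_pos {α : ℂ} (h : IsIntegral ℚ α) : 1 ≤ lc α := by
  have := im_ne h
  unfold lc
  have : (intMinpoly α).leadingCoeff ≠ 0 := by simpa using this
  omega

theorem im_roots {α : ℂ} (h : IsIntegral ℚ α) :
    ((intMinpoly α).map (Int.castRingHom ℂ)).roots = cr α := by
  obtain ⟨-, c, hc, hm⟩ := im_spec h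
  have : (intMinpoly α).map (Int.castRingHom ℂ) =
      ((intMinpoly α).map (Int.castRingHom ℚ)).map (algebraMap ℚ ℂ) := by
    rw [Polynomial.map_map]; congr 1
  rw [this, hm, Polynomial.map_mul, map_C, roots_C_mul]
  · rfl
  · simpa using hc

theorem cr_nodup {α : ℂ} (h : IsIntegral ℚ α) : (cr α).Nodup :=
  nodup_roots ((minpoly.irreducible h).separable.map)

theorem mem_cr {α z : ℂ} (h : IsIntegral ℚ α) : z ∈ cr α ↔ aeval z (minpoly ℚ α) = 0 := by
  unfold cr
  rw [mem_aroots]; simp [minpoly.ne_zero h]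

theorem self_mem_cr {α : ℂ} (h : IsIntegral ℚ α) : α ∈ cr α := by
  rw [mem_cr h]; exact minpoly.aeval _ _

theorem cr_card (α : ℂ) : (cr α).card = (minpoly ℚ α).natDegree := by
  unfold cr
  rw [aroots, ← (IsAlgClosed.splits _).natDegree_eq_card_roots, natDegree_map]

theorem mM_eq {α : ℂ} (h : IsIntegral ℚ α) :
    mahlerM α = (lc α : ℝ) * ((cr α).map (fun z => max 1 ‖z‖)).prod := by
  unfold mahlerM; rw [im_roots h]; rfl

theorem im_coeff_zero {α : ℂ} (h : IsIntegral ℚ α) :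
    (((intMinpoly α).coeff 0).natAbs : ℝ) = (lc α : ℝ) * ((cr α).map (fun z => ‖z‖)).prod := by
  have := (IsAlgClosed.splits ((intMinpoly α).map (Int.castRingHom ℂ))).coeff_zero_eq_leadingCoeff_mul_prod_roots
  rw [im_roots h, leadingCoeff_map_of_injective (by exact Int.cast_injective), coeff_map] at this
  have := congrArg norm this
  simp only [norm_mul, norm_pow, norm_neg, norm_one, one_pow, one_mul, eq_intCast, Complex.norm_intCast] at this
  rw [lc, Nat.cast_natAbs, Nat.cast_natAbs, Int.cast_abs, Int.cast_abs, this]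
  congr 1
  exact map_multiset_prod (normHom : ℂ →*₀ ℝ) _

theorem lc_int {α : ℂ} (h : IsIntegral ℤ α) : lc α = 1 := by
  have hQ : IsIntegral ℚ α := h.tower_top
  obtain ⟨hp, c, hc, hm⟩ := im_spec hQ
  have h1 : minpoly ℚ α = (minpoly ℤ α).map (Int.castRingHom ℚ) :=
    minpoly.isIntegrallyClosed_eq_field_fractions' ℚ h
  have h2 : intMinpoly α ∣ minpoly ℤ α := by
    rw [IsPrimitive.Int.dvd_iff_map_cast_dvd_map_cast _ _ hp, ← h1, hm]
    exact ⟨C c⁻¹, by rw [mul_comm (C c), mul_assoc, ← C_mul, mul_inv_cancel₀ hc]; simp⟩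
  obtain ⟨g, hg⟩ := h2
  have h3 := congrArg leadingCoeff hg
  rw [(minpoly.monic h).leadingCoeff, leadingCoeff_mul] at h3
  unfold lc
  exact Int.isUnit_iff_natAbs_eq.mp (IsUnit.of_mul_eq_one _ h3.symm)

def Pre (x : ℂ) : Prop := (Set.range fun m : ℕ => mahlerC^[m] x).Finite

theorem Pre.of_step {x : ℂ} (h : Pre (mahlerC x)) : Pre x := by
  refine (h.union (Set.finite_singleton x)).subset ?_
  rintro _ ⟨m, rfl⟩
  cases m with
  | zero => right; simp
  | succ m => left; exact ⟨m, by simp⟩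

theorem Pre.of_fixed {x : ℂ} (h : mahlerC x = x) : Pre x := by
  refine (Set.finite_singleton x).subset ?_
  rintro _ ⟨m, rfl⟩
  exact Function.iterate_fixed h m

theorem cr_nat (n : ℕ) : cr (n : ℂ) = {(n : ℂ)} := by
  unfold cr
  have : (n : ℂ) = algebraMap ℚ ℂ n := by simp
  rw [this, minpoly.eq_X_sub_C, aroots_X_sub_C]

theorem isInt_nat (n : ℕ) : IsIntegral ℤ (n : ℂ) := by
  simpa using (isIntegral_algebraMap : IsIntegral ℤ (algebraMap ℤ ℂ (n : ℤ)))

theorem mahlerC_nat (n : ℕ) : mahlerC n = ((max 1 n : ℕ) : ℂ) := by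
  have h := isInt_nat n
  unfold mahlerC
  rw [mM_eq h.tower_top, lc_int h, cr_nat]
  simp
  norm_cast

theorem Pre.nat (n : ℕ) : Pre n := by
  apply Pre.of_step
  rw [mahlerC_nat]
  apply Pre.of_fixed
  rw [mahlerC_nat]
  simp

/-- all conjugates of norm at least one -/
theorem Pre.of_ge {α : ℂ} (h : IsIntegral ℚ α) (hz : ∀ z ∈ cr α, 1 ≤ ‖z‖) : Pre α := by
  apply Pre.of_step
  have : mahlerC α = (((intMinpoly α).coeff 0).natAbs : ℂ) := by
    unfold mahlerC
    rw [mM_eq h, Multiset.map_congr rfl (fun z hz' => max_eq_right (hz z hz')), ← im_coeff_zero h]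
    exact Complex.ofReal_natCast _
  rw [this]
  exact Pre.nat _

theorem Pre.of_le {α : ℂ} (h : IsIntegral ℚ α) (hz : ∀ z ∈ cr α, ‖z‖ ≤ 1) : Pre α := by
  apply Pre.of_step
  have : mahlerC α = (lc α : ℂ) := by
    unfold mahlerC
    rw [mM_eq h, Multiset.map_congr rfl (fun z hz' => max_eq_left (hz z hz'))]
    simp
  rw [this]
  exact Pre.nat _

theorem cr_scale {γ : ℂ} (h : IsIntegral ℚ γ) {m : ℕ} (hm : m ≠ 0) {z : ℂ}
    (hz : z ∈ cr (γ * m)) : z / m ∈ cr γ := by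
  have hm' : (m : ℂ) ≠ 0 := by exact_mod_cast hm
  have h' : IsIntegral ℚ (γ * m) := h.mul (isInt_nat m).tower_top
  rw [mem_cr h'] at hz
  rw [mem_cr h]
  have h1 : minpoly ℚ (γ * m) ∣ (minpoly ℚ γ).comp (C (m : ℚ)⁻¹ * X) := by
    apply minpoly.dvd
    rw [aeval_comp]
    have : (aeval (γ * m)) (C (m : ℚ)⁻¹ * X) = γ := by
      simp; field_simp
    rw [this, minpoly.aeval]
  obtain ⟨g, hg⟩ := h1
  have h2 := congrArg (aeval z) hg
  rw [aeval_comp, map_mul _ (minpoly ℚ (γ * m)) g, hz, zero_mul] at h2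
  convert h2 using 2
  simp; field_simp

theorem main_int (j : ℕ) : ∀ (γ : ℝ) (γ' : ℂ) (N : ℕ), IsIntegral ℤ (γ : ℂ) → 0 < N →
    ‖γ'‖ ≤ γ → γ * ‖γ'‖ = N → (∀ z ∈ cr (γ : ℂ), z = γ ∨ z = γ' ∨ ‖z‖ ^ 2 = N) →
    1 ≤ ‖γ'‖ * 2 ^ j → Pre (γ : ℂ) := by
  induction j with
  | zero =>
    intro γ γ' N hi hN hle hmul hz hj
    refine Pre.of_ge hi.tower_top fun z hz' => ?_
    have hN1 : (1 : ℝ) ≤ N := by exact_mod_cast hN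
    simp only [pow_zero, mul_one] at hj
    rcases hz z hz' with rfl | rfl | h
    · rw [Complex.norm_real, Real.norm_eq_abs, abs_of_nonneg] <;> linarith
    · exact hj
    · nlinarith [norm_nonneg z]
  | succ j ih =>
    intro γ γ' N hi hN hle hmul hz hj
    have hQ : IsIntegral ℚ (γ : ℂ) := hi.tower_top
    have hN1 : (1 : ℝ) ≤ N := by exact_mod_cast hN
    have hγ1 : 1 ≤ γ := by nlinarith [norm_nonneg γ']
    have hγn : ‖(γ : ℂ)‖ = γ := by
      rw [Complex.norm_real, Real.norm_eq_abs, abs_of_nonneg]; linarith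
    by_cases hall : ∀ z ∈ cr (γ : ℂ), 1 ≤ ‖z‖
    · exact Pre.of_ge hQ hall
    push Not at hall
    obtain ⟨w, hw, hw1⟩ := hall
    have hwγ : w = γ' := by
      rcases hz w hw with rfl | rfl | h
      · linarith
      · rfl
      · nlinarith [norm_nonneg w]
    subst hwγ
    have hne : w ≠ γ := by rintro rfl; linarith
    obtain ⟨A, hA⟩ := Multiset.exists_cons_of_mem (self_mem_cr hQ)
    have hwA : w ∈ A := by
      rw [hA] at hw; exact (Multiset.mem_cons.mp hw).resolve_left hne
    obtain ⟨B, hB⟩ := Multiset.exists_cons_of_mem hwA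
    rw [hB] at hA
    have hnd := cr_nodup hQ
    rw [hA] at hnd
    rw [Multiset.nodup_cons, Multiset.nodup_cons] at hnd
    have hBn : ∀ z ∈ B, ‖z‖ = √N := by
      intro z hzB
      have hz1 : z ∈ cr (γ : ℂ) := by rw [hA]; simp [hzB]
      rcases hz z hz1 with h | h | h
      · exfalso; apply hnd.1; rw [← h]; simp [hzB]
      · exfalso; apply hnd.2.1; rw [← h]; exact hzB
      · rw [← h, Real.sqrt_sq (norm_nonneg z)]
    have hD : 1 ≤ √(N : ℝ) := by rw [Real.one_le_sqrt]; exact hN1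
    have e1 : (B.map (fun z => ‖z‖)).prod = √N ^ B.card := by
      rw [Multiset.map_congr rfl hBn]; simp
    have e2 : (B.map (fun z => max 1 ‖z‖)).prod = √N ^ B.card := by
      rw [Multiset.map_congr rfl (fun z hz => by rw [hBn z hz, max_eq_right hD])]; simp
    have hM := mM_eq hQ
    have hc := im_coeff_zero hQ
    rw [lc_int hi, hA, Multiset.map_cons, Multiset.map_cons, Multiset.prod_cons,
      Multiset.prod_cons, hγn] at hM hc
    rw [e2, max_eq_right hγ1, max_eq_left hw1.le] at hM
    rw [e1, ← mul_assoc γ, hmul] at hc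
    set c := ((intMinpoly (γ : ℂ)).coeff 0).natAbs
    set k := B.card
    have hdvd : N ∣ c := by
      rw [← Nat.pow_dvd_pow_iff (two_ne_zero)]
      refine ⟨N ^ k, ?_⟩
      have : (c : ℝ) ^ 2 = N ^ 2 * N ^ k := by
        rw [hc]
        simp only [Nat.cast_one, one_mul]
        rw [mul_pow, ← pow_mul, mul_comm k, pow_mul, Real.sq_sqrt (by positivity)]
      exact_mod_cast this
    obtain ⟨m, hm⟩ := hdvd
    have hmk : (√N : ℝ) ^ k = m := by
      rw [hm] at hc; push_cast at hc
      have : (N : ℝ) * m = N * √N ^ k := by rw [hc]; ring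
      exact (mul_left_cancel₀ (by positivity) this).symm
    have hM' : mahlerC γ = ((γ * m : ℝ) : ℂ) := by
      unfold mahlerC; rw [hM, hmk]; simp
    have hm1 : 1 ≤ m := by
      have : (1 : ℝ) ≤ m := by rw [← hmk]; exact one_le_pow₀ hD
      exact_mod_cast this
    rcases hm1.eq_or_lt with h1 | h2
    · apply Pre.of_fixed
      rw [hM', ← h1]; simp
    · apply Pre.of_step
      rw [hM']
      have hm2 : (2 : ℝ) ≤ m := by exact_mod_cast h2
      have hm0 : (m : ℂ) ≠ 0 := by norm_cast; omega
      refine ih (γ * m) (w * m) (N * m ^ 2) ?_ (by positivity) ?_ ?_ ?_ ?_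
      · push_cast; exact hi.mul (isInt_nat m)
      · rw [norm_mul, Complex.norm_natCast]; gcongr
      · rw [norm_mul, Complex.norm_natCast]; push_cast; rw [← hmul]; ring
      · intro z hz1
        push_cast at hz1 ⊢
        have := cr_scale hQ (by omega) hz1
        rcases hz _ this with h | h | h
        · left; rw [← h]; field_simp
        · right; left; rw [← h]; field_simp
        · right; right
          rw [norm_div, Complex.norm_natCast, div_pow, div_eq_iff (by positivity)] at h
          exact h
      · rw [norm_mul, Complex.norm_natCast]
        calc 1 ≤ ‖w‖ * 2 ^ (j + 1) := hj
          _ = ‖w‖ * 2 * 2 ^ j := by ring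
          _ ≤ _ := by gcongr

theorem main_int' (γ : ℝ) (γ' : ℂ) (N : ℕ) (hi : IsIntegral ℤ (γ : ℂ)) (hN : 0 < N)
    (h1 : ‖γ'‖ ≤ γ) (h2 : γ * ‖γ'‖ = N)
    (h3 : ∀ z ∈ cr (γ : ℂ), z = γ ∨ z = γ' ∨ ‖z‖ ^ 2 = N) : Pre (γ : ℂ) := by
  have hpos : 0 < ‖γ'‖ := by
    rcases (norm_nonneg γ').eq_or_lt with h | h
    · rw [← h, mul_zero] at h2
      have : N = 0 := by exact_mod_cast h2.symm
      omega
    · exact h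
  obtain ⟨j, hj⟩ := pow_unbounded_of_one_lt (1 / ‖γ'‖) (one_lt_two)
  refine main_int j γ γ' N hi hN h1 h2 h3 ?_
  rw [div_lt_iff₀ hpos] at hj
  linarith

/-- dividing by a linear factor preserves integrality of coefficients -/
theorem div_lin (z : ℂ) (n : ℕ) : ∀ g : ℂ[X], g.natDegree < n →
    (∀ i, IsIntegral ℤ (((X - C z) * g).coeff i)) → ∀ i, IsIntegral ℤ (g.coeff i) := by
  induction n with
  | zero => intro g hg; omega
  | succ n ih =>
    intro g hg hf
    by_cases hg0 : g = 0
    · subst hg0; intro i; simpa using isIntegral_zero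
    have hfl : ((X - C z) * g).leadingCoeff = g.leadingCoeff := by
      rw [leadingCoeff_mul, leadingCoeff_X_sub_C, one_mul]
    have hb : IsIntegral ℤ g.leadingCoeff := by rw [← hfl]; exact hf _
    have hbz : IsIntegral ℤ (g.leadingCoeff * z) := by
      have hlift : (X - C z) * g ∈ Polynomial.lifts (algebraMap (integralClosure ℤ ℂ) ℂ) := by
        rw [Polynomial.lifts_iff_coeff_lifts]
        intro i
        exact ⟨⟨_, hf i⟩, rfl⟩
      obtain ⟨q, hq⟩ := (Polynomial.mem_lifts _).mp hlift
      have h1 : aeval z q = 0 := by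
        rw [← eval_map_algebraMap, hq]; simp
      have h2 := isIntegral_leadingCoeff_smul q z h1
      have h3 : q.leadingCoeff • z = g.leadingCoeff * z := by
        rw [Algebra.smul_def, ← leadingCoeff_map_of_injective (FaithfulSMul.algebraMap_injective _ ℂ), hq, hfl]
      rw [h3] at h2
      exact isIntegral_trans _ h2
    have hsplit := g.eraseLead_add_C_mul_X_pow
    have hcl : ∀ i, IsIntegral ℤ ((C g.leadingCoeff * X ^ g.natDegree).coeff i) := by
      intro i; rw [coeff_C_mul_X_pow]; split_ifs
      · exact hb
      · exact isIntegral_zero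
    have herase : ∀ i, IsIntegral ℤ (g.eraseLead.coeff i) := by
      by_cases hd : g.natDegree = 0
      · have : g.eraseLead = 0 := by
          rw [eq_C_of_natDegree_eq_zero hd]; simp
        intro i; rw [this]; simpa using isIntegral_zero
      apply ih
      · have := g.eraseLead_natDegree_le; omega
      · intro i
        have : (X - C z) * g.eraseLead = (X - C z) * g - (C g.leadingCoeff * X ^ (g.natDegree + 1)
            - C (g.leadingCoeff * z) * X ^ g.natDegree) := by
          conv_rhs => enter [1]; rw [← hsplit]
          rw [C_mul]; ring
        rw [this, coeff_sub, coeff_sub, coeff_C_mul_X_pow, coeff_C_mul_X_pow]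
        refine (hf i).sub (IsIntegral.sub ?_ ?_) <;> split_ifs
        · exact hb
        · exact isIntegral_zero
        · exact hbz
        · exact isIntegral_zero
    intro i
    rw [← hsplit, coeff_add]
    exact (herase i).add (hcl i)

theorem div_lins (s : Multiset ℂ) : ∀ g : ℂ[X],
    (∀ i, IsIntegral ℤ (((s.map fun z => X - C z).prod * g).coeff i)) →
    ∀ i, IsIntegral ℤ (g.coeff i) := by
  induction s using Multiset.induction_on with
  | empty => intro g; simp
  | cons a s ih =>
    intro g hg
    apply ih
    apply div_lin a _ _ (Nat.lt_succ_self _)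
    simpa [mul_assoc] using hg

theorem isIntegral_lc_mul {α : ℂ} (h : IsIntegral ℚ α) {s t : Multiset ℂ} (hst : cr α = s + t) :
    IsIntegral ℤ ((lc α : ℂ) * t.prod) := by
  set F := (intMinpoly α).map (Int.castRingHom ℂ) with hF
  have h1 := (IsAlgClosed.splits F).eq_prod_roots
  rw [im_roots h, hst, Multiset.map_add, Multiset.prod_add, mul_left_comm] at h1
  have h2 := div_lins s (C F.leadingCoeff * (t.map fun z => X - C z).prod) (fun i => by
    rw [← h1, hF, coeff_map]; exact isIntegral_algebraMap (R := ℤ)) 0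
  have h3 : (C F.leadingCoeff * (t.map fun z => X - C z).prod).coeff 0 =
      F.leadingCoeff * ((-1) ^ t.card * t.prod) := by
    rw [coeff_C_mul, coeff_zero_eq_eval_zero, eval_multiset_prod]
    simp [Multiset.prod_map_neg]
  rw [h3, hF, leadingCoeff_map_of_injective (by exact Int.cast_injective)] at h2
  have hs : IsIntegral ℤ ((-1 : ℂ) ^ t.card) := (isIntegral_one.neg).pow _
  rw [eq_intCast] at h2
  have h4 : IsIntegral ℤ (((intMinpoly α).leadingCoeff : ℂ) * t.prod) := by
    have h5 : ((-1 : ℂ) ^ t.card) * (-1) ^ t.card = 1 := by rw [← mul_pow]; simp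
    have h6 : ((intMinpoly α).leadingCoeff : ℂ) * t.prod =
        (-1) ^ t.card * (((intMinpoly α).leadingCoeff : ℂ) * ((-1) ^ t.card * t.prod)) := by
      linear_combination (-(((intMinpoly α).leadingCoeff : ℂ) * t.prod)) * h5
    rw [h6]
    exact hs.mul h2
  unfold lc
  rcases Int.natAbs_eq (intMinpoly α).leadingCoeff with h | h
  · rw [h] at h4; simpa using h4
  · rw [h] at h4; simpa using h4.neg

theorem conj_hom {γ z : ℂ} (h : IsIntegral ℚ γ) (hz : z ∈ cr γ) :
    ∃ φ : algebraicClosure ℚ ℂ →ₐ[ℚ] ℂ,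
      φ ⟨γ, mem_algebraicClosure_iff.mpr h.isAlgebraic⟩ = z := by
  apply IntermediateField.exists_algHom_of_splits_of_aeval
  · intro s
    exact ⟨(isIntegral_algebraMap_iff (algebraMap (algebraicClosure ℚ ℂ) ℂ).injective).mp
      (mem_algebraicClosure_iff.mp s.2).isIntegral, IsAlgClosed.splits _⟩
  · rw [mem_cr h] at hz
    rw [← hz]
    congr 1
    rw [← minpoly.algebraMap_eq (algebraMap (algebraicClosure ℚ ℂ) ℂ).injective]
    rfl

theorem alg_of_mem_cr {α u : ℂ} (h : IsIntegral ℚ α) (hu : u ∈ cr α) : u ∈ algebraicClosure ℚ ℂ := by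
  rw [mem_algebraicClosure_iff]
  exact ⟨minpoly ℚ α, minpoly.ne_zero h, (mem_cr h).mp hu⟩

theorem hom_mem_cr {α u : ℂ} (h : IsIntegral ℚ α) (hu : u ∈ cr α)
    (φ : algebraicClosure ℚ ℂ →ₐ[ℚ] ℂ) : φ ⟨u, alg_of_mem_cr h hu⟩ ∈ cr α := by
  rw [mem_cr h, aeval_algHom_apply]
  have : aeval (⟨u, alg_of_mem_cr h hu⟩ : algebraicClosure ℚ ℂ) (minpoly ℚ α) = 0 := by
    apply (algebraMap (algebraicClosure ℚ ℂ) ℂ).injective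
    rw [← aeval_algebraMap_apply, map_zero]
    exact (mem_cr h).mp hu
  rw [this, map_zero]

theorem conj_mem_cr {α u : ℂ} (h : IsIntegral ℚ α) (hu : u ∈ cr α) :
    starRingEnd ℂ u ∈ cr α := by
  rw [mem_cr h] at hu ⊢
  have h1 := aeval_algHom_apply (Complex.conjAe.toAlgHom.restrictScalars ℚ) u (minpoly ℚ α)
  rw [hu, map_zero] at h1
  exact h1

theorem c0_pos {α : ℂ} (h : IsIntegral ℚ α) (h0 : α ≠ 0) :
    0 < ((intMinpoly α).coeff 0).natAbs := by
  have h1 := im_coeff_zero h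
  have h2 : (0 : ℝ) < (lc α : ℝ) * ((cr α).map (fun z => ‖z‖)).prod := by
    apply mul_pos
    · exact_mod_cast lc_pos h
    · apply Multiset.prod_pos
      intro a ha
      obtain ⟨z, hz, rfl⟩ := Multiset.mem_map.mp ha
      rw [norm_pos_iff]
      rintro rfl
      rw [mem_cr h] at hz
      apply minpoly.coeff_zero_ne_zero h h0
      rw [← coeff_zero_eq_aeval_zero'] at hz
      simpa using hz
  rw [← h1] at h2
  exact_mod_cast h2

theorem pre_quad {α u v : ℂ} (h : IsIntegral ℚ α) (h0 : α ≠ 0) (hcr : cr α = {u, v})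
    (hu : starRingEnd ℂ u = u) (hu1 : 1 < ‖u‖) (hv1 : ‖v‖ ≤ 1) : Pre α := by
  obtain ⟨r, rfl⟩ := Complex.conj_eq_iff_real.mp hu
  have hum : (r : ℂ) ∈ cr α := by rw [hcr]; simp
  obtain ⟨e, he, hr⟩ : ∃ e : ℤ, e * e = 1 ∧ |r| = e * r := by
    rcases abs_choice r with h | h
    · exact ⟨1, by norm_num, by rw [h]; simp⟩
    · exact ⟨-1, by norm_num, by rw [h]; simp⟩
  have hen : ‖(e : ℂ)‖ = 1 := by
    have : ‖(e : ℂ)‖ * ‖(e : ℂ)‖ = 1 := by rw [← norm_mul]; norm_cast; rw [he]; simp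
    nlinarith [norm_nonneg (e : ℂ)]
  have hint : IsIntegral ℤ ((e : ℂ) * ((lc α : ℂ) * r)) := by
    refine IsIntegral.mul (isIntegral_algebraMap (R := ℤ) (x := e)) ?_
    have := isIntegral_lc_mul h (s := {v}) (t := {(r : ℂ)}) (by rw [hcr, add_comm]; rfl)
    simpa using this
  have hγ : (((lc α : ℝ) * |r| : ℝ) : ℂ) = (e : ℂ) * ((lc α : ℂ) * r) := by
    rw [hr]; push_cast; ring
  apply Pre.of_step
  have hM : mahlerC α = (((lc α : ℝ) * |r| : ℝ) : ℂ) := by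
    unfold mahlerC
    rw [mM_eq h, hcr]
    simp only [Multiset.insert_eq_cons, Multiset.map_cons, Multiset.map_singleton,
      Multiset.prod_cons, Multiset.prod_singleton]
    rw [max_eq_right hu1.le, max_eq_left hv1, mul_one, Complex.norm_real, Real.norm_eq_abs]
  rw [hM]
  have hc := im_coeff_zero h
  rw [hcr] at hc
  simp only [Multiset.insert_eq_cons, Multiset.map_cons, Multiset.map_singleton,
      Multiset.prod_cons, Multiset.prod_singleton] at hc
  rw [Complex.norm_real, Real.norm_eq_abs] at hc hu1
  refine main_int' _ ((e : ℂ) * ((lc α : ℂ) * v)) (lc α * ((intMinpoly α).coeff 0).natAbs)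
    (by rw [hγ]; exact hint) (Nat.mul_pos (lc_pos h) (c0_pos h h0)) ?_ ?_ ?_
  · rw [norm_mul, norm_mul, hen, Complex.norm_natCast, one_mul]
    gcongr; linarith
  · rw [norm_mul, norm_mul, hen, Complex.norm_natCast]; push_cast; rw [hc]; ring
  · intro z hz
    rw [hγ] at hz ⊢
    obtain ⟨φ, hφ⟩ := conj_hom hint.tower_top hz
    have h1 := hom_mem_cr h hum φ
    have h2 : z = (e : ℂ) * ((lc α : ℂ) * φ ⟨r, alg_of_mem_cr h hum⟩) := by
      rw [← hφ]
      have : (⟨(e : ℂ) * ((lc α : ℂ) * r), mem_algebraicClosure_iff.mpr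
        (IsIntegral.tower_top (A := ℚ) hint).isAlgebraic⟩ : algebraicClosure ℚ ℂ) =
        (e : algebraicClosure ℚ ℂ) * ((lc α : algebraicClosure ℚ ℂ) * ⟨r, alg_of_mem_cr h hum⟩) := by
        apply Subtype.ext; push_cast; rfl
      rw [this]; simp
    rw [hcr] at h1
    simp only [Multiset.insert_eq_cons, Multiset.mem_cons, Multiset.mem_singleton] at h1
    rcases h1 with h1 | h1
    · left; rw [h2, h1]
    · right; left; rw [h2, h1]

theorem pre_quart {α u w : ℂ} (h : IsIntegral ℚ α) (h0 : α ≠ 0)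
    (hcr : cr α = {u, starRingEnd ℂ u, w, starRingEnd ℂ w})
    (hu1 : 1 < ‖u‖) (hw1 : ‖w‖ ≤ 1) : Pre α := by
  have hum : u ∈ cr α := by rw [hcr]; simp
  have hum' : starRingEnd ℂ u ∈ cr α := by rw [hcr]; simp
  have hnd := cr_nodup h
  have hint : IsIntegral ℤ ((lc α : ℂ) * (u * starRingEnd ℂ u)) := by
    have := isIntegral_lc_mul h (s := {w, starRingEnd ℂ w}) (t := {u, starRingEnd ℂ u})
      (by rw [hcr, add_comm]; rfl)
    simpa using this
  have hγ : (((lc α : ℝ) * ‖u‖ ^ 2 : ℝ) : ℂ) = (lc α : ℂ) * (u * starRingEnd ℂ u) := by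
    rw [Complex.mul_conj, Complex.normSq_eq_norm_sq]; push_cast; ring
  apply Pre.of_step
  have hM : mahlerC α = (((lc α : ℝ) * ‖u‖ ^ 2 : ℝ) : ℂ) := by
    unfold mahlerC
    rw [mM_eq h, hcr]
    simp only [Multiset.insert_eq_cons, Multiset.map_cons, Multiset.map_singleton,
      Multiset.prod_cons, Multiset.prod_singleton, RCLike.norm_conj]
    rw [max_eq_right hu1.le, max_eq_left hw1, mul_one, mul_one, sq]
  rw [hM]
  have hc := im_coeff_zero h
  rw [hcr] at hc hnd
  simp only [Multiset.insert_eq_cons, Multiset.map_cons, Multiset.map_singleton,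
      Multiset.prod_cons, Multiset.prod_singleton, RCLike.norm_conj] at hc
  refine main_int' _ ((lc α : ℂ) * (w * starRingEnd ℂ w)) (lc α * ((intMinpoly α).coeff 0).natAbs)
    (by rw [hγ]; exact hint) (Nat.mul_pos (lc_pos h) (c0_pos h h0)) ?_ ?_ ?_
  · rw [norm_mul, norm_mul, RCLike.norm_conj, Complex.norm_natCast]
    have : ‖w‖ * ‖w‖ ≤ ‖u‖ ^ 2 := by nlinarith [norm_nonneg w]
    gcongr
  · rw [norm_mul, norm_mul, RCLike.norm_conj, Complex.norm_natCast]
    push_cast; rw [hc]; ring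
  · intro z hz
    rw [hγ] at hz ⊢
    obtain ⟨φ, hφ⟩ := conj_hom hint.tower_top hz
    have h1 := hom_mem_cr h hum φ
    have h1' := hom_mem_cr h hum' φ
    have hne : φ ⟨u, alg_of_mem_cr h hum⟩ ≠ φ ⟨starRingEnd ℂ u, alg_of_mem_cr h hum'⟩ := by
      intro heq
      have := congrArg Subtype.val (φ.injective heq)
      simp only [Multiset.insert_eq_cons, Multiset.nodup_cons, Multiset.mem_cons, not_or] at hnd
      exact hnd.1.1 this
    have h2 : z = (lc α : ℂ) * (φ ⟨u, alg_of_mem_cr h hum⟩ *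
        φ ⟨starRingEnd ℂ u, alg_of_mem_cr h hum'⟩) := by
      rw [← hφ]
      have : (⟨(lc α : ℂ) * (u * starRingEnd ℂ u), mem_algebraicClosure_iff.mpr
        (IsIntegral.tower_top (A := ℚ) hint).isAlgebraic⟩ : algebraicClosure ℚ ℂ) =
        ((lc α : algebraicClosure ℚ ℂ) * (⟨u, alg_of_mem_cr h hum⟩ *
          ⟨starRingEnd ℂ u, alg_of_mem_cr h hum'⟩)) := by
        apply Subtype.ext; push_cast; rfl
      rw [this, map_mul, map_mul, map_natCast]
    rw [hcr] at h1 h1'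
    generalize φ ⟨u, alg_of_mem_cr h hum⟩ = a at *
    generalize φ ⟨starRingEnd ℂ u, alg_of_mem_cr h hum'⟩ = b at *
    simp only [Multiset.insert_eq_cons, Multiset.mem_cons, Multiset.mem_singleton] at h1 h1'
    have key : ‖a‖ * ‖b‖ = ‖u‖ * ‖w‖ → ‖z‖ ^ 2 = ((lc α * ((intMinpoly α).coeff 0).natAbs : ℕ) : ℝ) := by
      intro hab
      rw [h2, norm_mul, norm_mul, hab, Complex.norm_natCast]
      push_cast; rw [hc]; ring
    rcases h1 with h1 | h1 | h1 | h1 <;> rcases h1' with h1' | h1' | h1' | h1' <;>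
    first
    | (exfalso; apply hne; rw [h1, h1']; done)
    | (left; rw [h2, h1, h1']; done)
    | (left; rw [h2, h1, h1', mul_comm u]; done)
    | (right; left; rw [h2, h1, h1']; done)
    | (right; left; rw [h2, h1, h1', mul_comm w]; done)
    | (right; right; apply key; simp only [h1, h1', RCLike.norm_conj]; done)
    | (right; right; apply key; simp only [h1, h1', RCLike.norm_conj]; ring)

theorem pre_all {α : ℂ} (h : IsIntegral ℚ α)
    (hdeg : (minpoly ℚ α).natDegree ∣ 4)
    (hreal : (minpoly ℚ α).natDegree = 4 → ∀ z ∈ cr α, starRingEnd ℂ z ≠ z) : Pre α := by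
  by_cases h0 : α = 0
  · subst h0; exact_mod_cast Pre.nat 0
  have hcard := cr_card α
  have hd : (minpoly ℚ α).natDegree = 1 ∨ (minpoly ℚ α).natDegree = 2 ∨
      (minpoly ℚ α).natDegree = 4 := by
    have := Nat.le_of_dvd (by norm_num) hdeg
    interval_cases (minpoly ℚ α).natDegree <;> omega
  have hnd := cr_nodup h
  rcases hd with hd | hd | hd
  · rw [hd, Multiset.card_eq_one] at hcard
    obtain ⟨a, ha⟩ := hcard
    rcases le_total 1 ‖a‖ with h1 | h1
    · exact Pre.of_ge h (by simpa [ha] using h1)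
    · exact Pre.of_le h (by simpa [ha] using h1)
  · rw [hd, Multiset.card_eq_two] at hcard
    obtain ⟨a, b, hab⟩ := hcard
    have key : ∀ u v : ℂ, cr α = {u, v} → 1 < ‖u‖ → ‖v‖ < 1 → Pre α := by
      intro u v huv hu hv
      refine pre_quad h h0 huv ?_ hu hv.le
      have := conj_mem_cr h (u := u) (by rw [huv]; simp)
      rw [huv] at this
      simp only [Multiset.insert_eq_cons, Multiset.mem_cons, Multiset.mem_singleton] at this
      refine this.resolve_right fun h' => ?_
      have := congrArg norm h'
      rw [RCLike.norm_conj] at this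
      linarith
    by_cases hge : 1 ≤ ‖a‖ ∧ 1 ≤ ‖b‖
    · exact Pre.of_ge h (by simpa [hab] using hge)
    by_cases hle : ‖a‖ ≤ 1 ∧ ‖b‖ ≤ 1
    · exact Pre.of_le h (by simpa [hab] using hle)
    rcases lt_or_ge ‖a‖ 1 with ha | ha
    · exact key b a (by rw [hab, Multiset.pair_comm]) (by by_contra hb; exact hle ⟨ha.le, not_lt.mp hb⟩) ha
    · have hb : ‖b‖ < 1 := by by_contra hb; exact hge ⟨ha, not_lt.mp hb⟩
      exact key a b hab (by by_contra ha'; exact hle ⟨not_lt.mp ha', hb.le⟩) hb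
  · have hr := hreal hd
    rw [hd] at hcard
    obtain ⟨A, hA⟩ := Multiset.exists_cons_of_mem (self_mem_cr h)
    have hA1 : starRingEnd ℂ α ∈ A := by
      have := conj_mem_cr h (self_mem_cr h)
      rw [hA] at this
      exact (Multiset.mem_cons.mp this).resolve_left (hr _ (self_mem_cr h))
    obtain ⟨B, rfl⟩ := Multiset.exists_cons_of_mem hA1
    rw [hA] at hcard hnd
    simp only [Multiset.card_cons, Nat.reduceEqDiff] at hcard
    obtain ⟨b, c, rfl⟩ := Multiset.card_eq_two.mp hcard
    have hbm : b ∈ cr α := by rw [hA]; simp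
    have hb := conj_mem_cr h hbm
    rw [hA] at hb
    simp only [Multiset.insert_eq_cons, Multiset.mem_cons, Multiset.mem_singleton,
      Multiset.nodup_cons, not_or] at hb hnd
    have hbc : starRingEnd ℂ b = c := by
      rcases hb with hb | hb | hb | hb
      · exfalso
        have : b = starRingEnd ℂ α := by rw [← hb, Complex.conj_conj]
        exact hnd.2.1.1 this.symm
      · exfalso
        have : b = α := by rw [← Complex.conj_conj b, hb, Complex.conj_conj]
        exact hnd.1.2.1 this.symm
      · exact absurd hb (hr b hbm)
      · exact hb
    subst hbc
    have hA' : cr α = {b, starRingEnd ℂ b, α, starRingEnd ℂ α} := by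
      rw [hA]
      exact add_comm ({α, starRingEnd ℂ α} : Multiset ℂ) {b, starRingEnd ℂ b}
    by_cases hge : 1 ≤ ‖α‖ ∧ 1 ≤ ‖b‖
    · exact Pre.of_ge h (by rw [hA]; simpa using hge)
    by_cases hle : ‖α‖ ≤ 1 ∧ ‖b‖ ≤ 1
    · exact Pre.of_le h (by rw [hA]; simpa using hle)
    rcases lt_or_ge ‖α‖ 1 with ha | ha
    · exact pre_quart h h0 hA' (by by_contra hb; exact hle ⟨ha.le, not_lt.mp hb⟩) ha.le
    · have hb : ‖b‖ < 1 := by by_contra hb; exact hge ⟨ha, not_lt.mp hb⟩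
      exact pre_quart h h0 hA (by by_contra ha'; exact hle ⟨not_lt.mp ha', hb.le⟩) hb.le

theorem totally_imaginary_quartic_preperiodic (K : IntermediateField ℚ ℂ)
    [FiniteDimensional ℚ K] (h4 : Module.finrank ℚ K = 4)
    (him : ∀ φ : K →+* ℂ, ∃ x : K, (φ x).im ≠ 0) :
    ∀ α : K, (Set.range fun m : ℕ => mahlerC^[m] (α : ℂ)).Finite := by
  intro α
  have hα : IsIntegral ℚ α := Algebra.IsIntegral.isIntegral α
  have hmp : minpoly ℚ (α : ℂ) = minpoly ℚ α :=
    minpoly.algebraMap_eq (algebraMap K ℂ).injective α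
  have h : IsIntegral ℚ (α : ℂ) := hα.map K.val
  refine pre_all h ?_ ?_
  · rw [hmp, ← h4]; exact minpoly.degree_dvd hα
  · intro hd z hz hreal
    rw [hmp] at hd
    rw [mem_cr h, hmp] at hz
    obtain ⟨φ, hφ⟩ : ∃ φ : K →ₐ[ℚ] ℂ, φ α = z := by
      apply IntermediateField.exists_algHom_of_splits_of_aeval
      · intro s
        exact ⟨Algebra.IsIntegral.isIntegral s, IsAlgClosed.splits _⟩
      · exact hz
    have htop : IntermediateField.adjoin ℚ {α} = ⊤ := by
      apply IntermediateField.eq_of_le_of_finrank_eq le_top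
      rw [IntermediateField.adjoin.finrank hα, hd, IntermediateField.finrank_top', h4]
    obtain ⟨x, hx⟩ := him φ
    apply hx
    have hhom : (Complex.conjAe.toAlgHom.restrictScalars ℚ).comp φ = φ := by
      have htop' : Algebra.adjoin ℚ {α} = ⊤ := by
        rw [← IntermediateField.adjoin_simple_toSubalgebra_of_isAlgebraic hα.isAlgebraic, htop]
        rfl
      apply AlgHom.ext_of_adjoin_eq_top htop'
      intro y hy
      rw [Set.mem_singleton_iff.mp hy]
      change starRingEnd ℂ (φ α) = φ α
      rw [hφ, hreal]
    have := DFunLike.congr_fun hhom x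
    exact Complex.conj_eq_iff_im.mp this
end

section
/- Let K be a number field with an odd number 2n+1 of pairwise non-complex-conjugate embeddings σ₁,...,σ_{2n+1} into ℂ, where for some q ≤ n the embeddings σ_{n-q+2},...,σ_{n+q+1} are complex and the rest are real. Then there exists an algebraic unit α ∈ K satisfying |σ₁(α)| > ... > |σ_{n+1}(α)| > 1 > |σ_{n+2}(α)| > ... > |σ_{2n+1}(α)| and |σ₁(α)·σ_{n+2}(α)| < 1. -/
/-- Real multiples of a vector in the real span of an additive subgroup stay at bounded
distance from the subgroup. -/
theorem aux_span_approx {E : Type*} [SeminormedAddCommGroup E] [NormedSpace ℝ E]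
    (S : Submodule ℤ E) (v : E) (hv : v ∈ Submodule.span ℝ (S : Set E)) :
    ∃ C : ℝ, ∀ t : ℝ, ∃ l ∈ S, ‖l - t • v‖ ≤ C := by
  induction hv using Submodule.span_induction with
  | mem x hx =>
    refine ⟨‖x‖, fun t => ⟨⌊t⌋ • x, S.smul_mem _ hx, ?_⟩⟩
    have h : ⌊t⌋ • x - t • x = ((⌊t⌋ : ℝ) - t) • x := by
      rw [sub_smul, Int.cast_smul_eq_zsmul]
    rw [h, norm_smul]
    have h2 : ‖(⌊t⌋ : ℝ) - t‖ ≤ 1 := by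
      rw [Real.norm_eq_abs, abs_le]
      constructor <;> linarith [Int.floor_le t, Int.lt_floor_add_one t]
    nlinarith [norm_nonneg x]
  | zero => exact ⟨0, fun t => ⟨0, S.zero_mem, by simp⟩⟩
  | add x y _ _ hx hy =>
    obtain ⟨C, hC⟩ := hx
    obtain ⟨D, hD⟩ := hy
    refine ⟨C + D, fun t => ?_⟩
    obtain ⟨l, hl, h1⟩ := hC t
    obtain ⟨m, hm, h2⟩ := hD t
    refine ⟨l + m, S.add_mem hl hm, ?_⟩
    have h : l + m - t • (x + y) = (l - t • x) + (m - t • y) := by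
      rw [smul_add]; abel
    rw [h]
    exact (norm_add_le _ _).trans (add_le_add h1 h2)
  | smul a x _ hx =>
    obtain ⟨C, hC⟩ := hx
    refine ⟨C, fun t => ?_⟩
    obtain ⟨l, hl, h1⟩ := hC (t * a)
    exact ⟨l, hl, by rwa [smul_smul]⟩

open NumberField NumberField.Units NumberField.Units.dirichletUnitTheorem in
/-- Units approximate every direction of the trace-zero hyperplane. -/
theorem aux_unit_approx (K : Type*) [Field K] [NumberField K] (y : InfinitePlace K → ℝ)
    (hy : ∑ w, (w.mult : ℝ) * y w = 0) :
    ∃ C : ℝ, ∀ t : ℝ, ∃ u : (𝓞 K)ˣ, ∀ w : InfinitePlace K,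
      |Real.log (w (u : K)) - t * y w| ≤ C := by
  classical
  obtain ⟨C, hC⟩ := aux_span_approx (unitLattice K) (fun w => (w.1.mult : ℝ) * y w.1)
    (by rw [unitLattice_span_eq_top]; trivial)
  refine ⟨C + Fintype.card (InfinitePlace K) * C, fun t => ?_⟩
  obtain ⟨l, hl, hlC⟩ := hC t
  have hC0 : 0 ≤ C := (norm_nonneg _).trans hlC
  obtain ⟨u, -, rfl⟩ := hl
  refine ⟨u.toMul, ?_⟩
  set d : InfinitePlace K → ℝ := fun w =>
    (w.mult : ℝ) * (Real.log (w (u.toMul : K)) - t * y w) with hd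
  have hsum : ∑ w, d w = 0 := by
    have h := sum_mult_mul_log u.toMul
    have : ∑ w, d w = ∑ w : InfinitePlace K, (w.mult : ℝ) * Real.log (w (u.toMul : K))
        - t * ∑ w, (w.mult : ℝ) * y w := by
      rw [Finset.mul_sum, ← Finset.sum_sub_distrib]
      exact Finset.sum_congr rfl fun w _ => by simp only [hd]; ring
    rw [this, hy, h]; simp
  have hne : ∀ w : InfinitePlace K, w ≠ w₀ → |d w| ≤ C := by
    intro w hw
    have h := (norm_le_pi_norm _ (⟨w, hw⟩ : {w : InfinitePlace K // w ≠ w₀})).trans hlC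
    rw [Real.norm_eq_abs] at h
    refine le_trans (le_of_eq ?_) h
    congr 1
    change _ = (w.mult : ℝ) * Real.log (w (u.toMul : K)) - t * ((w.mult : ℝ) * y w)
    simp only [hd]; ring
  have hall : ∀ w, |d w| ≤ C + Fintype.card (InfinitePlace K) * C := by
    intro w
    have hcard : 0 ≤ (Fintype.card (InfinitePlace K) : ℝ) * C := by positivity
    by_cases hw : w = w₀
    · have h1 : d w = - ∑ v ∈ Finset.univ.erase w, d v := by
        have := Finset.add_sum_erase Finset.univ d (Finset.mem_univ w)
        linarith
      rw [h1, abs_neg]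
      have h2 : |∑ v ∈ Finset.univ.erase w, d v| ≤ ∑ v ∈ Finset.univ.erase w, C :=
        (Finset.abs_sum_le_sum_abs _ _).trans (Finset.sum_le_sum fun v hv =>
          hne v (by rw [← hw]; exact Finset.ne_of_mem_erase hv))
      have h3 : ∑ v ∈ Finset.univ.erase w, C ≤ ∑ v : InfinitePlace K, C :=
        Finset.sum_le_sum_of_subset_of_nonneg (Finset.erase_subset _ _) fun _ _ _ => hC0
      rw [Finset.sum_const (s := Finset.univ), Finset.card_univ, nsmul_eq_mul] at h3
      linarith
    · linarith [hne w hw]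
  intro w
  refine le_trans ?_ (hall w)
  simp only [hd]
  rw [abs_mul, Nat.abs_cast]
  have := InfinitePlace.one_le_mult (w := w)
  nlinarith [abs_nonneg (Real.log (w (u.toMul : K)) - t * y w)]

/-- The combinatorial choice of a trace-zero vector with the required inequalities. -/
theorem aux_vector (n q : ℕ) (hn : 1 ≤ n) (m : ℕ → ℝ)
    (hm : ∀ k, m k = if n + 1 - q ≤ k ∧ k ≤ n + q then 2 else 1) :
    ∃ z : ℕ → ℝ, ∑ k ∈ Finset.range (2 * n + 1), m k * z k = 0 ∧
      (∀ i j : ℕ, i < j → z j + 1 ≤ z i) ∧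
      (∀ i : ℕ, i ≤ n → 1 ≤ z i) ∧ (∀ i : ℕ, n < i → z i ≤ -1) ∧
      z 0 + z (n + 1) ≤ -1 := by
  have hm1 : ∀ k, 1 ≤ m k := by
    intro k; rw [hm]; split_ifs <;> norm_num
  set W := ∑ k ∈ Finset.range n, m (n + 1 + k) with hW
  have hWpos : 0 < W := Finset.sum_pos (fun k _ => by linarith [hm1 (n + 1 + k)])
    ⟨0, by simp; omega⟩
  have hW1 : ∑ k ∈ Finset.range (n + 1), m k = W + m 0 := by
    rw [← Finset.sum_range_reflect, Finset.sum_range_succ]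
    congr 1
    · refine Finset.sum_congr rfl fun k hk => ?_
      have hk := Finset.mem_range.mp hk
      rw [hm, hm]
      congr 1
      apply propext
      constructor <;> intro h <;> omega
    · simp
  set S := ∑ k ∈ Finset.range (2 * n + 1), m k * (k : ℝ) with hS
  have hS0 : 0 ≤ S := Finset.sum_nonneg fun k _ =>
    mul_nonneg (by linarith [hm1 k]) (Nat.cast_nonneg k)
  set a : ℝ := S + n + 1 with ha
  set b : ℝ := (a * (W + m 0) - S) / W with hb
  have hbW : b * W = a * (W + m 0) - S := by rw [hb]; field_simp
  have hn0 : (0 : ℝ) ≤ n := Nat.cast_nonneg n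
  have hab : a ≤ b := by
    rw [hb, le_div_iff₀ hWpos]
    nlinarith [hm1 0]
  refine ⟨fun k => (if k ≤ n then a else -b) - k, ?_, ?_, ?_, ?_, ?_⟩
  · have h1 : ∑ k ∈ Finset.range (2 * n + 1), m k * ((if k ≤ n then a else -b) - k)
        = ∑ k ∈ Finset.range (2 * n + 1), m k * (if k ≤ n then a else -b) - S := by
      rw [hS, ← Finset.sum_sub_distrib]
      exact Finset.sum_congr rfl fun k _ => by ring
    rw [h1, show 2 * n + 1 = (n + 1) + n by ring, Finset.sum_range_add]
    have h2 : ∑ k ∈ Finset.range (n + 1), m k * (if k ≤ n then a else -b) = (W + m 0) * a := by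
      rw [← hW1, Finset.sum_mul]
      refine Finset.sum_congr rfl fun k hk => ?_
      have hk := Finset.mem_range.mp hk
      rw [if_pos (by omega)]
    have h3 : ∑ k ∈ Finset.range n, m (n + 1 + k) * (if n + 1 + k ≤ n then a else -b)
        = W * (-b) := by
      rw [hW, Finset.sum_mul]
      refine Finset.sum_congr rfl fun k _ => ?_
      rw [if_neg (by omega)]
    rw [h2, h3]
    linarith
  · intro i j hij
    have hc : (i : ℝ) + 1 ≤ j := by exact_mod_cast hij
    dsimp only
    split_ifs <;> first | linarith | omega
  · intro i hi
    have hc : (i : ℝ) ≤ n := by exact_mod_cast hi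
    dsimp only
    rw [if_pos hi]; linarith
  · intro i hi
    have hc : (n : ℝ) + 1 ≤ i := by exact_mod_cast hi
    dsimp only
    rw [if_neg (by omega)]; linarith
  · dsimp only
    rw [if_pos (by omega), if_neg (by omega)]
    push_cast
    linarith

theorem exists_unit_with_prescribed_archimedean_distribution
    (K : Type*) [Field K] [NumberField K] (n q : ℕ) (hn : 1 ≤ n) (hq : q ≤ n)
    (σ : Fin (2 * n + 1) → (K →+* ℂ))
    (hpair : ∀ i j : Fin (2 * n + 1), i ≠ j →
      σ i ≠ σ j ∧ (starRingEnd ℂ).comp (σ i) ≠ σ j)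
    (hfull : ∀ φ : K →+* ℂ, ∃ i, φ = σ i ∨ φ = (starRingEnd ℂ).comp (σ i))
    (hcomplex : ∀ i : Fin (2 * n + 1), n + 1 - q ≤ (i : ℕ) → (i : ℕ) ≤ n + q →
      (starRingEnd ℂ).comp (σ i) ≠ σ i)
    (hreal : ∀ i : Fin (2 * n + 1), ((i : ℕ) < n + 1 - q ∨ n + q < (i : ℕ)) →
      (starRingEnd ℂ).comp (σ i) = σ i) :
    ∃ α : K, α ≠ 0 ∧ IsIntegral ℤ α ∧ IsIntegral ℤ α⁻¹ ∧
      (∀ i j : Fin (2 * n + 1), i < j → ‖σ j α‖ < ‖σ i α‖) ∧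
      (∀ i : Fin (2 * n + 1), (i : ℕ) ≤ n → 1 < ‖σ i α‖) ∧
      (∀ i : Fin (2 * n + 1), n < (i : ℕ) → ‖σ i α‖ < 1) ∧
      ‖σ ⟨0, by omega⟩ α * σ ⟨n + 1, by omega⟩ α‖ < 1 := by
  classical
  obtain ⟨z, hz0, hz1, hz2, hz3, hz4⟩ := aux_vector n q hn _ (fun k => rfl)
  have hbij : Function.Bijective (fun i => NumberField.InfinitePlace.mk (σ i)) := by
    constructor
    · intro i j hij
      by_contra hne
      rcases NumberField.InfinitePlace.mk_eq_iff.mp hij with h | h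
      · exact (hpair i j hne).1 h
      · exact (hpair i j hne).2 h
    · intro w
      obtain ⟨i, hi⟩ := hfull w.embedding
      refine ⟨i, ?_⟩
      dsimp only
      rw [← NumberField.InfinitePlace.mk_embedding w]
      refine NumberField.InfinitePlace.mk_eq_iff.mpr ?_
      rcases hi with h | h
      · exact Or.inl h.symm
      · exact Or.inr h.symm
  let e := Equiv.ofBijective _ hbij
  have he : ∀ i, e i = NumberField.InfinitePlace.mk (σ i) := fun i => rfl
  have hmult : ∀ i : Fin (2 * n + 1), ((e i).mult : ℝ) =
      if n + 1 - q ≤ (i : ℕ) ∧ (i : ℕ) ≤ n + q then 2 else 1 := by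
    intro i
    rw [he]
    split_ifs with h
    · rw [NumberField.InfinitePlace.IsComplex.mult_eq_two]
      · norm_num
      · rw [← NumberField.InfinitePlace.not_isReal_iff_isComplex,
          NumberField.InfinitePlace.isReal_mk_iff, NumberField.ComplexEmbedding.isReal_iff]
        exact hcomplex i h.1 h.2
    · rw [NumberField.InfinitePlace.IsReal.mult_eq_one]
      · norm_num
      · rw [NumberField.InfinitePlace.isReal_mk_iff, NumberField.ComplexEmbedding.isReal_iff]
        exact hreal i (by omega)
  obtain ⟨C, hC⟩ := aux_unit_approx K (fun w => z (e.symm w : ℕ)) (by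
    rw [← e.sum_comp]
    simp only [Equiv.symm_apply_apply, hmult]
    rw [← hz0, Finset.sum_range])
  obtain ⟨u, hu⟩ := hC (2 * C + 1)
  have hC0 : 0 ≤ C := (abs_nonneg _).trans (hu (e 0))
  have hα : ((u : NumberField.RingOfIntegers K) : K) ≠ 0 := NumberField.Units.coe_ne_zero u
  have hpos : ∀ i, 0 < ‖σ i (u : K)‖ := fun i => by
    rw [norm_pos_iff]; exact (map_ne_zero (σ i)).mpr hα
  have key : ∀ i : Fin (2 * n + 1),
      |Real.log ‖σ i (u : K)‖ - (2 * C + 1) * z i| ≤ C := by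
    intro i
    have := hu (e i)
    rw [Equiv.symm_apply_apply] at this
    exact this
  refine ⟨(u : K), hα, NumberField.RingOfIntegers.isIntegral_coe _, ?_, ?_, ?_, ?_, ?_⟩
  · have : ((u : K))⁻¹ = ((u⁻¹ : (NumberField.RingOfIntegers K)ˣ) : K) := by simp
    rw [this]
    exact NumberField.RingOfIntegers.isIntegral_coe _
  · intro i j hij
    rw [← Real.log_lt_log_iff (hpos j) (hpos i)]
    have h1 := abs_le.mp (key i)
    have h2 := abs_le.mp (key j)
    have h3 := hz1 i j hij
    nlinarith
  · intro i hi
    rw [← Real.log_pos_iff (hpos i).le]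
    have h1 := abs_le.mp (key i)
    have h3 := hz2 i hi
    nlinarith
  · intro i hi
    rw [← Real.log_neg_iff (hpos i)]
    have h1 := abs_le.mp (key i)
    have h3 := hz3 i hi
    nlinarith
  · rw [norm_mul, ← Real.log_neg_iff (mul_pos (hpos _) (hpos _)),
      Real.log_mul (hpos _).ne' (hpos _).ne']
    have h1 := abs_le.mp (key ⟨0, by omega⟩)
    have h2 := abs_le.mp (key ⟨n + 1, by omega⟩)
    dsimp only at h1 h2
    nlinarith
end
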